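/- arXiv:2103.15410 — 5 statements merged into one kernel-verified Lean document; each statement's English description precedes it below -/
import Mathlib

section
/- Let c > 0 and let p, q : ℝ → ℝ be continuous on [c, ∞) with p(r) > 0 for all r ≥ c and p continuously differentiable on [c, ∞). Suppose there exists l₀ ∈ ℂ such that every solution of Lx = l₀x on [c, ∞) is of class L²(c, ∞). Then for every l ∈ ℂ, every solution of Lx = lx on [c, ∞) is of class L²(c, ∞). -/
open MeasureTheory Set Filter

/-- `x` is a solution of the Sturm–Liouville equation `-(p x')' + q x = l x` on `I`:
there is a function `x'` which is the derivative of `x` on `I`, and `p · x'` is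
differentiable on `I` with `-(p x')'(r) + q(r) x(r) = l x(r)` there. -/
def IsSLSolution (p q : ℝ → ℝ) (l : ℂ) (I : Set ℝ) (x : ℝ → ℂ) : Prop :=
  ∃ x' : ℝ → ℂ,
    (∀ r ∈ I, HasDerivWithinAt x (x' r) I r) ∧
    (∀ r ∈ I, HasDerivWithinAt (fun s => (p s : ℂ) * x' s) ((q r : ℂ) * x r - l * x r) I r)

section LinearODE

variable {E : Type*} [NormedAddCommGroup E] [NormedSpace ℝ E] [NormedSpace ℂ E]

/-- The terms of the Picard (Peano–Baker) series for `v' = A v`, `v c = v₀`. -/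
noncomputable def picardTerm (A : ℝ → E →L[ℂ] E) (c : ℝ) (v₀ : E) : ℕ → ℝ → E
  | 0 => fun _ => v₀
  | n + 1 => fun t => ∫ s in c..t, A s (picardTerm A c v₀ n s)

variable {A : ℝ → E →L[ℂ] E} (c : ℝ) (v₀ : E)

lemma continuous_picardTerm (hA : Continuous A) (n : ℕ) : Continuous (picardTerm A c v₀ n) := by
  induction n with
  | zero => exact continuous_const
  | succ n ih =>
    exact intervalIntegral.continuous_primitive
      (fun a b => (hA.clm_apply ih).intervalIntegrable a b) c

lemma hasDerivAt_picardTerm_succ [CompleteSpace E] (hA : Continuous A) (n : ℕ) (t : ℝ) :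
    HasDerivAt (picardTerm A c v₀ (n + 1)) (A t (picardTerm A c v₀ n t)) t :=
  (hA.clm_apply (continuous_picardTerm c v₀ hA n)).integral_hasStrictDerivAt c t |>.hasDerivAt

lemma norm_picardTerm_le (hA : Continuous A) {K R : ℝ}
    (hK : ∀ t, |t - c| ≤ R → ‖A t‖ ≤ K) (n : ℕ) {t : ℝ} (ht : |t - c| ≤ R) :
    ‖picardTerm A c v₀ n t‖ ≤ ‖v₀‖ * K ^ n * |t - c| ^ n / n.factorial := by
  induction n generalizing t with
  | zero => simp [picardTerm]
  | succ n ih =>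
    have hK0 : 0 ≤ K := (norm_nonneg _).trans (hK t ht)
    have hcont : Continuous fun s => A s (picardTerm A c v₀ n s) :=
      hA.clm_apply (continuous_picardTerm c v₀ hA n)
    calc ‖picardTerm A c v₀ (n + 1) t‖
        ≤ ∫ s in uIoc c t, ‖A s (picardTerm A c v₀ n s)‖ :=
          intervalIntegral.norm_integral_le_integral_norm_uIoc
      _ ≤ ∫ s in uIoc c t, ‖v₀‖ * K ^ (n + 1) / n.factorial * |s - c| ^ n := by
          refine setIntegral_mono_on (hcont.norm.integrableOn_uIoc)
            (Continuous.integrableOn_uIoc (by fun_prop)) measurableSet_uIoc fun s hs => ?_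
          have hs' : |s - c| ≤ R := (abs_sub_left_of_mem_uIcc (uIoc_subset_uIcc hs)).trans ht
          calc ‖A s (picardTerm A c v₀ n s)‖
              ≤ K * (‖v₀‖ * K ^ n * |s - c| ^ n / n.factorial) :=
                (A s).le_of_opNorm_le_of_le (hK s hs') (ih hs')
            _ = _ := by ring
      _ = _ := by
          rw [integral_const_mul, integral_pow_abs_sub_uIoc, Nat.factorial_succ]
          push_cast
          field_simp

/-- Global existence for linear ordinary differential equations with continuous coefficients. -/
theorem exists_hasDerivAt_linear [CompleteSpace E] (hA : Continuous A) :
    ∃ v : ℝ → E, v c = v₀ ∧ ∀ t, HasDerivAt v (A t (v t)) t := by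
  have hbound (R : ℝ) : ∃ K, 0 ≤ K ∧ ∀ t, |t - c| ≤ R → ‖A t‖ ≤ K := by
    obtain ⟨K, hK⟩ := (isCompact_closedBall c R).exists_bound_of_continuousOn hA.continuousOn
    exact ⟨max K 0, le_max_right _ _, fun t ht =>
      (hK t (by rwa [mem_closedBall_iff_norm, Real.norm_eq_abs])).trans (le_max_left _ _)⟩
  have hsum (t : ℝ) : Summable fun n => picardTerm A c v₀ n t := by
    obtain ⟨K, -, hK⟩ := hbound |t - c|
    refine .of_norm_bounded ((Real.summable_pow_div_factorial (K * |t - c|)).mul_left ‖v₀‖)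
      fun n => (norm_picardTerm_le c v₀ hA hK n le_rfl).trans_eq ?_
    rw [mul_pow]; ring
  refine ⟨fun t => ∑' n, picardTerm A c v₀ n t, ?_, fun t => ?_⟩
  · dsimp only
    rw [tsum_eq_single 0 fun n hn => ?_]
    · rfl
    · obtain ⟨m, rfl⟩ := Nat.exists_eq_succ_of_ne_zero hn
      exact intervalIntegral.integral_same
  · set R := |t - c| + 1
    have hR : 0 ≤ R := by positivity
    obtain ⟨K, hK0, hK⟩ := hbound R
    have hmem {s : ℝ} (hs : s ∈ Metric.ball c R) : |s - c| ≤ R := by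
      rw [mem_ball_iff_norm, Real.norm_eq_abs] at hs; exact hs.le
    have hc : c ∈ Metric.ball c R := Metric.mem_ball_self (by positivity)
    have ht : t ∈ Metric.ball c R := by
      rw [mem_ball_iff_norm, Real.norm_eq_abs]; exact lt_add_one _
    have key := hasDerivAt_tsum_of_isPreconnected
      (u := fun n : ℕ => K * ‖v₀‖ * ((K * R) ^ n / n.factorial))
      ((Real.summable_pow_div_factorial (K * R)).mul_left _) Metric.isOpen_ball
      (convex_ball c R).isPreconnected
      (fun n s _ => hasDerivAt_picardTerm_succ c v₀ hA n s)
      (fun n s hs => by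
        calc ‖A s (picardTerm A c v₀ n s)‖
            ≤ K * (‖v₀‖ * K ^ n * |s - c| ^ n / n.factorial) :=
              (A s).le_of_opNorm_le_of_le (hK s (hmem hs))
                (norm_picardTerm_le c v₀ hA hK n (hmem hs))
          _ ≤ K * (‖v₀‖ * K ^ n * R ^ n / n.factorial) := by gcongr; exact hmem hs
          _ = _ := by rw [mul_pow]; ring)
      hc ((summable_nat_add_iff 1).2 (hsum c)) ht
    rw [← (A t).map_tsum (hsum t)] at key
    have heq : (fun t => ∑' n, picardTerm A c v₀ n t)
        = fun t => v₀ + ∑' n, picardTerm A c v₀ (n + 1) t :=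
      funext fun s => (hsum s).tsum_eq_zero_add
    exact (key.const_add v₀).congr_of_eventuallyEq (.of_eq heq)

end LinearODE

/-- The equation `L x = l x`, as a first-order system for `(x, p x')`. -/
lemma exists_slSystem_solution {p q : ℝ → ℝ} (hp : Continuous p) (hq : Continuous q)
    (hpne : ∀ t, p t ≠ 0) (l : ℂ) (c : ℝ) (a b : ℂ) :
    ∃ x y : ℝ → ℂ, x c = a ∧ y c = b ∧ (∀ t, HasDerivAt x (y t / p t) t) ∧
      ∀ t, HasDerivAt y ((q t - l) * x t) t := by
  have hpc : Continuous fun t => ((p t : ℂ))⁻¹ :=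
    (Complex.continuous_ofReal.comp hp).inv₀ fun t =>
      Complex.ofReal_ne_zero.2 (hpne t)
  have hqc : Continuous fun t => (q t : ℂ) - l :=
    (Complex.continuous_ofReal.comp hq).sub continuous_const
  obtain ⟨v, hv, hv'⟩ := exists_hasDerivAt_linear (E := ℂ × ℂ)
    (A := fun t => ((p t : ℂ))⁻¹ • ((ContinuousLinearMap.snd ℂ ℂ ℂ).prod 0)
      + ((q t : ℂ) - l) • ((0 : ℂ × ℂ →L[ℂ] ℂ).prod (ContinuousLinearMap.fst ℂ ℂ ℂ)))
    c (a, b) ((hpc.smul continuous_const).add (hqc.smul continuous_const))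
  refine ⟨fun t => (v t).1, fun t => (v t).2, by simp [hv], by simp [hv], fun t => ?_, fun t => ?_⟩
  · refine ((hasFDerivAt_fst (𝕜 := ℝ) (p := v t)).comp_hasDerivAt t (hv' t)).congr_deriv ?_
    simp [div_eq_inv_mul]
  · refine ((hasFDerivAt_snd (𝕜 := ℝ) (p := v t)).comp_hasDerivAt t (hv' t)).congr_deriv ?_
    simp

/-- Grönwall's inequality with an integrable coefficient. -/
lemma le_mul_exp_integral_of_deriv_le {c : ℝ} {M M' w : ℝ → ℝ}
    (hM : ContinuousOn M (Ici c)) (hM' : ∀ r ∈ Ioi c, HasDerivAt M (M' r) r)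
    (hw : Continuous w) (hle : ∀ r ∈ Ioi c, M' r ≤ w r * M r) {r : ℝ} (hr : c ≤ r) :
    M r ≤ M c * Real.exp (∫ s in c..r, w s) := by
  have hS (r : ℝ) : HasDerivAt (fun r => ∫ s in c..r, w s) (w r) r :=
    (hw.integral_hasStrictDerivAt c r).hasDerivAt
  have hScont : Continuous fun r => ∫ s in c..r, w s :=
    continuous_iff_continuousAt.2 fun r => (hS r).continuousAt
  have hF (r : ℝ) (hr : r ∈ Ioi c) := (hM' r hr).mul (hS r).neg.exp
  have hanti : AntitoneOn (fun r => M r * Real.exp (-∫ s in c..r, w s)) (Ici c) := by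
    refine antitoneOn_of_deriv_nonpos (convex_Ici c) (hM.mul (by fun_prop)) ?_ ?_ <;>
      rw [interior_Ici]
    · exact fun r hr => (hF r hr).differentiableAt.differentiableWithinAt
    · intro r hr
      refine (hF r hr).deriv.trans_le ?_
      have := mul_le_mul_of_nonneg_right (hle r hr) (Real.exp_pos (-∫ s in c..r, w s)).le
      simp only [Pi.neg_apply]
      linarith
  have h := hanti self_mem_Ici hr hr
  simp only [intervalIntegral.integral_same, neg_zero, Real.exp_zero, mul_one] at h
  rwa [Real.exp_neg, ← div_eq_mul_inv, div_le_iff₀ (Real.exp_pos _)] at h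

/-- If for some `l₀` every solution of `L x = l₀ x` on `[c, ∞)` is square integrable
near infinity, then for every `l` every solution of `L x = l x` is square
integrable near infinity. -/
theorem limit_circle_invariance_at_infinity
    (c : ℝ) (hc : 0 < c) (p q : ℝ → ℝ)
    (hq : ContinuousOn q (Ici c))
    (hp : ContDiffOn ℝ 1 p (Ici c))
    (hppos : ∀ r ∈ Ici c, 0 < p r)
    (l₀ : ℂ)
    (h₀ : ∀ x : ℝ → ℂ, IsSLSolution p q l₀ (Ici c) x →
      IntegrableOn (fun r => ‖x r‖ ^ 2) (Ioi c) volume) :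
    ∀ l : ℂ, ∀ x : ℝ → ℂ, IsSLSolution p q l (Ici c) x →
      IntegrableOn (fun r => ‖x r‖ ^ 2) (Ioi c) volume := by
  have hmaps (t : ℝ) : max c t ∈ Ici c := le_max_left c t
  set P : ℝ → ℝ := fun t => p (max c t)
  set Q : ℝ → ℝ := fun t => q (max c t)
  have hP : Continuous P :=
    hp.continuousOn.comp_continuous (continuous_const.max continuous_id) hmaps
  have hQ : Continuous Q := hq.comp_continuous (continuous_const.max continuous_id) hmaps
  have hPne (t : ℝ) : P t ≠ 0 := (hppos _ (hmaps t)).ne'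
  have hPeq {t : ℝ} (ht : t ∈ Ici c) : P t = p t := by simp only [P, max_eq_right (mem_Ici.1 ht)]
  have hQeq {t : ℝ} (ht : t ∈ Ici c) : Q t = q t := by simp only [Q, max_eq_right (mem_Ici.1 ht)]
  have hpC {t : ℝ} (ht : t ∈ Ici c) : (p t : ℂ) ≠ 0 := by exact_mod_cast (hppos t ht).ne'
  have hL2 {x y : ℝ → ℂ} (hx : ∀ t, HasDerivAt x (y t / P t) t)
      (hy : ∀ t, HasDerivAt y ((Q t - l₀) * x t) t) :
      IntegrableOn (fun r => ‖x r‖ ^ 2) (Ioi c) volume := by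
    refine h₀ x ⟨fun t => y t / P t, fun r _ => (hx r).hasDerivWithinAt, fun r hr => ?_⟩
    rw [← sub_mul, ← hQeq hr]
    have heq : ∀ s ∈ Ici c, (p s : ℂ) * (y s / P s) = y s := fun s hs => by
      rw [hPeq hs, mul_div_cancel₀ _ (hpC hs)]
    exact (hy r).hasDerivWithinAt.congr heq (heq r hr)
  obtain ⟨x₁, y₁, hx₁c, hy₁c, hx₁, hy₁⟩ := exists_slSystem_solution hP hQ hPne l₀ c 1 0
  obtain ⟨x₂, y₂, hx₂c, hy₂c, hx₂, hy₂⟩ := exists_slSystem_solution hP hQ hPne l₀ c 0 1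
  have hcx₁ : Continuous x₁ := continuous_iff_continuousAt.2 fun t => (hx₁ t).continuousAt
  have hcx₂ : Continuous x₂ := continuous_iff_continuousAt.2 fun t => (hx₂ t).continuousAt
  have hW (t : ℝ) : x₁ t * y₂ t - x₂ t * y₁ t = 1 := by
    have hd (t : ℝ) : HasDerivAt (fun t => x₁ t * y₂ t - x₂ t * y₁ t) 0 t := by
      refine (((hx₁ t).mul (hy₂ t)).sub ((hx₂ t).mul (hy₁ t))).congr_deriv ?_
      ring
    have := is_const_of_deriv_eq_zero (fun t => (hd t).differentiableAt) (fun t => (hd t).deriv) t c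
    simpa [hx₁c, hx₂c, hy₁c, hy₂c] using this
  set s : ℝ → ℝ := fun r => ‖x₁ r‖ ^ 2 + ‖x₂ r‖ ^ 2
  have hscont : Continuous s := by fun_prop
  have hs0 (r : ℝ) : 0 ≤ s r := by positivity
  have hsint : IntegrableOn s (Ioi c) volume := (hL2 hx₁ hy₁).add (hL2 hx₂ hy₂)
  rintro l x ⟨x', hx, hu⟩
  set u : ℝ → ℂ := fun s => p s * x' s with hu_def
  have hxu {r : ℝ} (hr : r ∈ Ici c) : x' r = u r / P r := by
    rw [hPeq hr, hu_def, mul_div_cancel_left₀ _ (hpC hr)]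
  have hxcont : ContinuousOn x (Ici c) := fun r hr => (hx r hr).continuousWithinAt
  -- Coefficients of `x` in the basis `x₁, x₂` given by variation of constants.
  set C₁ : ℝ → ℂ := fun r => x r * y₂ r - x₂ r * u r
  set C₂ : ℝ → ℂ := fun r => x₁ r * u r - x r * y₁ r
  have hC₁ {r : ℝ} (hr : r ∈ Ici c) :
      HasDerivWithinAt C₁ ((l - l₀) * x r * x₂ r) (Ici c) r := by
    refine (((hx r hr).mul (hy₂ r).hasDerivWithinAt).sub
      ((hx₂ r).hasDerivWithinAt.mul (hu r hr))).congr_deriv ?_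
    rw [hxu hr, hQeq hr]
    ring
  have hC₂ {r : ℝ} (hr : r ∈ Ici c) :
      HasDerivWithinAt C₂ (-((l - l₀) * x r * x₁ r)) (Ici c) r := by
    refine (((hx₁ r).hasDerivWithinAt.mul (hu r hr)).sub
      ((hx r hr).mul (hy₁ r).hasDerivWithinAt)).congr_deriv ?_
    rw [hxu hr, hQeq hr]
    ring
  have hxC (r : ℝ) : x r = C₁ r * x₁ r + C₂ r * x₂ r := by
    linear_combination (-x r) * hW r
  set M : ℝ → ℝ := fun r => ‖C₁ r‖ ^ 2 + ‖C₂ r‖ ^ 2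
  have hM {r : ℝ} (hr : r ∈ Ici c) := (hC₁ hr).norm_sq.add (hC₂ hr).norm_sq
  have hM0 (r : ℝ) : 0 ≤ M r := by positivity
  have cauchy (a b a' b' : ℝ) : (a * a' + b * b') ^ 2 ≤ (a ^ 2 + b ^ 2) * (a' ^ 2 + b' ^ 2) := by
    nlinarith [sq_nonneg (a * b' - b * a')]
  have hxM (r : ℝ) : ‖x r‖ ^ 2 ≤ M r * s r := by
    refine le_trans ?_ (cauchy _ _ _ _)
    gcongr
    calc ‖x r‖ = ‖C₁ r * x₁ r + C₂ r * x₂ r‖ := by rw [← hxC]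
      _ ≤ _ := (norm_add_le _ _).trans_eq (by rw [norm_mul, norm_mul])
  have hgron {r : ℝ} (hr : c ≤ r) :
      M r ≤ M c * Real.exp (∫ t in c..r, 2 * ‖l - l₀‖ * s t) := by
    refine le_mul_exp_integral_of_deriv_le (fun r hr => (hM hr).continuousWithinAt)
      (fun r hr => (hM (mem_Ici_of_Ioi hr)).hasDerivAt (Ici_mem_nhds hr)) (by fun_prop)
      (fun r _ => ?_) hr
    have h₁ := real_inner_le_norm (C₁ r) ((l - l₀) * x r * x₂ r)
    have h₂ := real_inner_le_norm (C₂ r) (-((l - l₀) * x r * x₁ r))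
    rw [norm_mul, norm_mul] at h₁
    rw [norm_neg, norm_mul, norm_mul] at h₂
    have hb : ‖x r‖ * (‖C₁ r‖ * ‖x₂ r‖ + ‖C₂ r‖ * ‖x₁ r‖) ≤ M r * s r := by
      refine abs_le_of_sq_le_sq' ?_ (mul_nonneg (hM0 r) (hs0 r)) |>.2
      have := cauchy ‖C₁ r‖ ‖C₂ r‖ ‖x₂ r‖ ‖x₁ r‖
      rw [add_comm (‖x₂ r‖ ^ 2)] at this
      rw [mul_pow, sq (M r * s r)]
      exact mul_le_mul (hxM r) this (sq_nonneg _) (mul_nonneg (hM0 r) (hs0 r))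
    have := mul_le_mul_of_nonneg_left hb (norm_nonneg (l - l₀))
    change _ ≤ 2 * ‖l - l₀‖ * s r * M r
    linarith
  have hMle {r : ℝ} (hr : c ≤ r) :
      M r ≤ M c * Real.exp (∫ t in Ioi c, 2 * ‖l - l₀‖ * s t) := by
    refine (hgron hr).trans ?_
    have := hM0 c
    gcongr
    rw [intervalIntegral.integral_of_le hr]
    exact setIntegral_mono_set (hsint.const_mul _)
      (Eventually.of_forall fun t => mul_nonneg (by positivity) (hs0 t))
      Ioc_subset_Ioi_self.eventuallyLE
  refine (hsint.const_mul (M c * Real.exp (∫ t in Ioi c, 2 * ‖l - l₀‖ * s t))).mono'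
    (((hxcont.mono Ioi_subset_Ici_self).norm.pow 2).aestronglyMeasurable measurableSet_Ioi) ?_
  refine (ae_restrict_iff' measurableSet_Ioi).2 (Eventually.of_forall fun r hr => ?_)
  rw [Real.norm_of_nonneg (sq_nonneg _)]
  exact (hxM r).trans (mul_le_mul_of_nonneg_right (hMle (le_of_lt hr)) (hs0 r))
end

section
/- Let c > 0 and let p, q : ℝ → ℝ be continuous on (0, c] with p(r) > 0 for all 0 < r ≤ c and p continuously differentiable on (0, c]. Suppose there exists l₀ ∈ ℂ such that every solution of Lx = l₀x on (0, c] is of class L²(0, c). Then for every l ∈ ℂ, every solution of Lx = lx on (0, c] is of class L²(0, c). -/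
open MeasureTheory Set Filter

/-- The radial retraction onto the closed ball of radius `R` is `2`-Lipschitz. -/
lemma norm_radialRetraction_sub_le {E : Type*} [NormedAddCommGroup E] [NormedSpace ℝ E]
    {R : ℝ} (hR : 0 < R) (x y : E) :
    ‖(R / max R ‖x‖) • x - (R / max R ‖y‖) • y‖ ≤ 2 * ‖x - y‖ := by
  have hx : 0 < max R ‖x‖ := lt_max_of_lt_left hR
  have hy : 0 < max R ‖y‖ := lt_max_of_lt_left hR
  have hs : R / max R ‖x‖ ≤ 1 := (div_le_one hx).2 (le_max_left _ _)
  have ht : ‖y‖ / max R ‖y‖ ≤ 1 := (div_le_one hy).2 (le_max_right _ _)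
  have hm : |max R ‖y‖ - max R ‖x‖| ≤ ‖x - y‖ := by
    refine (abs_max_sub_max_le_max R ‖y‖ R ‖x‖).trans ?_
    simpa [norm_sub_rev x y] using abs_norm_sub_norm_le y x
  have hdiff : |R / max R ‖x‖ - R / max R ‖y‖| * ‖y‖ ≤ ‖x - y‖ := by
    have e : R / max R ‖x‖ - R / max R ‖y‖
        = R / max R ‖x‖ * (max R ‖y‖ - max R ‖x‖) * (max R ‖y‖)⁻¹ := by
      field_simp
    rw [e, abs_mul, abs_mul, abs_of_pos (div_pos hR hx), abs_of_pos (inv_pos.2 hy)]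
    calc _ = R / max R ‖x‖ * (‖y‖ / max R ‖y‖) * |max R ‖y‖ - max R ‖x‖| := by ring
      _ ≤ 1 * |max R ‖y‖ - max R ‖x‖| := by
        gcongr
        exact mul_le_one₀ hs (by positivity) ht
      _ ≤ ‖x - y‖ := by simpa using hm
  calc _ = ‖(R / max R ‖x‖) • (x - y) + (R / max R ‖x‖ - R / max R ‖y‖) • y‖ := by
        congr 1; module
    _ ≤ R / max R ‖x‖ * ‖x - y‖ + |R / max R ‖x‖ - R / max R ‖y‖| * ‖y‖ := by
        refine (norm_add_le _ _).trans_eq ?_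
        rw [norm_smul, norm_smul, Real.norm_of_nonneg (by positivity), Real.norm_eq_abs]
    _ ≤ 1 * ‖x - y‖ + ‖x - y‖ := by gcongr
    _ = 2 * ‖x - y‖ := by ring

/-- Global existence for linear differential equations on a compact interval. -/
lemma exists_linearODE_solution_Icc {E : Type*} [NormedAddCommGroup E] [NormedSpace ℝ E]
    [CompleteSpace E] {a b : ℝ} (hab : a ≤ b) {A : ℝ → E →L[ℝ] E}
    (hA : ContinuousOn A (Icc a b)) (x₀ : E) :
    ∃ u : ℝ → E, u a = x₀ ∧ ∀ t ∈ Icc a b, HasDerivWithinAt u (A t (u t)) (Icc a b) t := by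
  obtain ⟨K, hK⟩ := isCompact_Icc.exists_bound_of_continuousOn hA
  have hK0 : 0 ≤ K := (norm_nonneg _).trans (hK a (left_mem_Icc.2 hab))
  lift K to NNReal using hK0
  set R : ℝ := (‖x₀‖ + 1) * Real.exp (K * (b - a)) with hRdef
  have hR : 0 < R := by positivity
  let ρ : E → E := fun x ↦ (R / max R ‖x‖) • x
  have hρR : ∀ x, ‖ρ x‖ ≤ R := fun x ↦ by
    have hx : 0 < max R ‖x‖ := lt_max_of_lt_left hR
    rw [norm_smul, Real.norm_of_nonneg (by positivity), div_mul_eq_mul_div, div_le_iff₀ hx]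
    exact mul_le_mul_of_nonneg_left (le_max_right _ _) hR.le
  have hρx : ∀ x, ‖ρ x‖ ≤ ‖x‖ := fun x ↦ by
    have hx : 0 < max R ‖x‖ := lt_max_of_lt_left hR
    rw [norm_smul, Real.norm_of_nonneg (by positivity)]
    exact mul_le_of_le_one_left (norm_nonneg _) ((div_le_one hx).2 (le_max_left _ _))
  have hPL : IsPicardLindelof (fun t x ↦ A t (ρ x)) (⟨a, left_mem_Icc.2 hab⟩ : Icc a b) x₀
      (K * R.toNNReal * (b - a).toNNReal) 0 (K * R.toNNReal) (K * 2) := by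
    refine ⟨fun t ht ↦ LipschitzWith.lipschitzOnWith (LipschitzWith.of_dist_le_mul fun x y ↦ ?_),
      fun x _ ↦ hA.clm_apply continuousOn_const, fun t ht x _ ↦ ?_, ?_⟩
    · rw [dist_eq_norm, dist_eq_norm, ← map_sub]
      refine ((A t).le_of_opNorm_le (hK t ht) _).trans ?_
      push_cast
      rw [mul_assoc]
      gcongr
      exact norm_radialRetraction_sub_le hR x y
    · push_cast
      rw [Real.coe_toNNReal _ hR.le]
      exact ((A t).le_of_opNorm_le (hK t ht) _).trans (by gcongr; exact hρR x)
    · push_cast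
      rw [Real.coe_toNNReal _ hR.le, Real.coe_toNNReal _ (sub_nonneg.2 hab)]
      simp [hab]
  obtain ⟨u, hu0, hu⟩ := hPL.exists_eq_forall_mem_Icc_hasDerivWithinAt₀
  have hbound : ∀ t ∈ Icc a b, ‖u t‖ ≤ R := by
    intro t ht
    have h := norm_le_gronwallBound_of_norm_deriv_right_le (δ := ‖x₀‖) (K := K) (ε := 0)
      (fun s hs ↦ (hu s hs).continuousWithinAt)
      (fun s hs ↦ (hu s (Ico_subset_Icc_self hs)).mono_of_mem_nhdsWithin
        (Icc_mem_nhdsGE_of_mem hs))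
      (by rw [← hu0]) (fun s hs ↦ by
        rw [add_zero]
        exact ((A s).le_of_opNorm_le (hK s (Ico_subset_Icc_self hs)) _).trans
          (by gcongr; exact hρx _)) t ht
    rw [gronwallBound_ε0] at h
    refine h.trans ?_
    rw [hRdef]
    gcongr
    · linarith
    · exact ht.2
  refine ⟨u, hu0, fun t ht ↦ ?_⟩
  have hρu : ρ (u t) = u t := by
    simp only [ρ]
    rw [max_eq_left (hbound t ht), div_self hR.ne', one_smul]
  simpa only [hρu] using hu t ht

/-- Global existence for linear differential equations on a half-open interval. -/
lemma exists_linearODE_solution_Ico {E : Type*} [NormedAddCommGroup E] [NormedSpace ℝ E]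
    [CompleteSpace E] {a b : ℝ} {A : ℝ → E →L[ℝ] E}
    (hA : ContinuousOn A (Ico a b)) (x₀ : E) :
    ∃ u : ℝ → E, (a < b → u a = x₀) ∧
      ∀ t ∈ Ico a b, HasDerivWithinAt u (A t (u t)) (Ico a b) t := by
  have hex : ∀ T : ℝ, ∃ u : ℝ → E, T ∈ Ico a b →
      u a = x₀ ∧ ∀ t ∈ Icc a T, HasDerivWithinAt u (A t (u t)) (Icc a T) t := by
    intro T
    by_cases hT : T ∈ Ico a b
    · obtain ⟨u, hu⟩ := exists_linearODE_solution_Icc hT.1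
        (hA.mono fun s hs ↦ ⟨hs.1, hs.2.trans_lt hT.2⟩) x₀
      exact ⟨u, fun _ ↦ hu⟩
    · exact ⟨0, fun h ↦ absurd h hT⟩
  choose U hU using hex
  have huniq : ∀ S ∈ Ico a b, ∀ T ∈ Ico a b, S ≤ T → ∀ t ∈ Icc a S, U S t = U T t := by
    intro S hS T hT hST
    obtain ⟨K, hK⟩ := isCompact_Icc.exists_bound_of_continuousOn
      (hA.mono fun s (hs : s ∈ Icc a S) ↦ ⟨hs.1, hs.2.trans_lt hS.2⟩)
    have hK0 : 0 ≤ K := (norm_nonneg _).trans (hK a (left_mem_Icc.2 hS.1))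
    lift K to NNReal using hK0
    refine ODE_solution_unique_of_mem_Icc_right (v := fun t x ↦ A t x) (s := fun _ ↦ univ) (K := K)
      (fun t ht ↦ ((A t).lipschitzWith_of_opNorm_le
        (hK t (Ico_subset_Icc_self ht))).lipschitzOnWith)
      (fun t ht ↦ ((hU S hS).2 t ht).continuousWithinAt)
      (fun t ht ↦ ((hU S hS).2 t (Ico_subset_Icc_self ht)).mono_of_mem_nhdsWithin
        (Icc_mem_nhdsGE_of_mem ht)) (fun _ _ ↦ mem_univ _)
      (fun t ht ↦ ((hU T hT).2 t ⟨ht.1, ht.2.trans hST⟩).continuousWithinAt.mono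
        (Icc_subset_Icc_right hST))
      (fun t ht ↦ ((hU T hT).2 t ⟨ht.1, ht.2.le.trans hST⟩).mono_of_mem_nhdsWithin
        (Icc_mem_nhdsGE_of_mem ⟨ht.1, ht.2.trans_le hST⟩)) (fun _ _ ↦ mem_univ _)
      ((hU S hS).1.trans (hU T hT).1.symm)
  have hmid : ∀ t ∈ Ico a b, (t + b) / 2 ∈ Ico a b := fun t ht ↦
    ⟨by linarith [ht.1, ht.2], by linarith [ht.2]⟩
  have heq : ∀ T ∈ Ico a b, ∀ t ∈ Icc a T, U ((t + b) / 2) t = U T t := by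
    intro T hT t ht
    have ht' : t ∈ Ico a b := ⟨ht.1, ht.2.trans_lt hT.2⟩
    rcases le_total ((t + b) / 2) T with h | h
    · exact huniq _ (hmid t ht') T hT h t ⟨ht.1, by linarith [ht'.2]⟩
    · exact (huniq T hT _ (hmid t ht') h t ht).symm
  refine ⟨fun t ↦ U ((t + b) / 2) t, fun hab ↦ (hU _ (hmid a (left_mem_Ico.2 hab))).1,
    fun t ht ↦ ?_⟩
  have hlt : t < (t + b) / 2 := by linarith [ht.2]
  have hnhds : Icc a ((t + b) / 2) ∈ nhdsWithin t (Ico a b) := by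
    filter_upwards [self_mem_nhdsWithin, mem_nhdsWithin_of_mem_nhds (Iio_mem_nhds hlt)]
      with s hs hs' using ⟨hs.1, hs'.le⟩
  refine (((hU _ (hmid t ht)).2 t ⟨ht.1, hlt.le⟩).mono_of_mem_nhdsWithin
    hnhds).congr_of_eventuallyEq ?_ rfl
  filter_upwards [hnhds] with s hs using heq _ (hmid t ht) s hs

/-- Global existence for linear differential equations on a half-open interval, with initial
value at the right end point. -/
lemma exists_linearODE_solution_Ioc {E : Type*} [NormedAddCommGroup E] [NormedSpace ℝ E]
    [CompleteSpace E] {a b : ℝ} {A : ℝ → E →L[ℝ] E}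
    (hA : ContinuousOn A (Ioc a b)) (x₀ : E) :
    ∃ u : ℝ → E, (a < b → u b = x₀) ∧
      ∀ t ∈ Ioc a b, HasDerivWithinAt u (A t (u t)) (Ioc a b) t := by
  have hmaps : MapsTo (fun t : ℝ ↦ -t) (Ico (-b) (-a)) (Ioc a b) := fun t ht ↦
    ⟨by linarith [ht.2], by linarith [ht.1]⟩
  have hmaps' : MapsTo (fun t : ℝ ↦ -t) (Ioc a b) (Ico (-b) (-a)) := fun t ht ↦
    ⟨by linarith [ht.2], by linarith [ht.1]⟩
  obtain ⟨u, hu0, hu⟩ := exists_linearODE_solution_Ico (A := fun t ↦ -A (-t))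
    (hA.comp continuous_neg.continuousOn hmaps).neg x₀
  refine ⟨fun t ↦ u (-t), fun hab ↦ hu0 (neg_lt_neg hab), fun t ht ↦ ?_⟩
  have h := (hu (-t) (hmaps' ht)).scomp t (hasDerivAt_neg t).hasDerivWithinAt hmaps'
  simpa [Function.comp_def] using h

/-- The Sturm–Liouville equation as a first order system in `x` and the quasi-derivative `p x'`. -/
lemma isSLSolution_iff {p q : ℝ → ℝ} {l : ℂ} {I : Set ℝ} (hp : ∀ r ∈ I, p r ≠ 0) {x : ℝ → ℂ} :
    IsSLSolution p q l I x ↔ ∃ y : ℝ → ℂ,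
      (∀ r ∈ I, HasDerivWithinAt x ((p r : ℂ)⁻¹ * y r) I r) ∧
      (∀ r ∈ I, HasDerivWithinAt y (((q r : ℂ) - l) * x r) I r) := by
  constructor
  · rintro ⟨x', hx, hy⟩
    refine ⟨fun s ↦ (p s : ℂ) * x' s, fun r hr ↦ ?_, fun r hr ↦ ?_⟩
    · have : (p r : ℂ) ≠ 0 := mod_cast hp r hr
      simpa [this] using hx r hr
    · simpa [sub_mul] using hy r hr
  · rintro ⟨y, hx, hy⟩
    refine ⟨fun s ↦ (p s : ℂ)⁻¹ * y s, hx, fun r hr ↦ ?_⟩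
    have hcongr : ∀ s ∈ I, (p s : ℂ) * ((p s : ℂ)⁻¹ * y s) = y s := fun s hs ↦
      mul_inv_cancel_left₀ (mod_cast hp s hs) _
    simpa [sub_mul] using (hy r hr).congr hcongr (hcongr r hr)

/-- Existence of solutions of the Sturm–Liouville system with prescribed data at `c`. -/
lemma exists_slSystem_solution_s1 {c : ℝ} (hc : 0 < c) {p q : ℝ → ℝ}
    (hq : ContinuousOn q (Ioc 0 c)) (hp : ContinuousOn p (Ioc 0 c))
    (hp0 : ∀ r ∈ Ioc 0 c, p r ≠ 0) (l α β : ℂ) :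
    ∃ x y : ℝ → ℂ, x c = α ∧ y c = β ∧
      (∀ r ∈ Ioc 0 c, HasDerivWithinAt x ((p r : ℂ)⁻¹ * y r) (Ioc 0 c) r) ∧
      (∀ r ∈ Ioc 0 c, HasDerivWithinAt y (((q r : ℂ) - l) * x r) (Ioc 0 c) r) := by
  let M : ℂ × ℂ →L[ℝ] ℂ × ℂ :=
    (ContinuousLinearMap.inl ℝ ℂ ℂ).comp (ContinuousLinearMap.snd ℝ ℂ ℂ)
  let N : ℂ × ℂ →L[ℝ] ℂ × ℂ :=
    (ContinuousLinearMap.inr ℝ ℂ ℂ).comp (ContinuousLinearMap.fst ℝ ℂ ℂ)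
  have hA : ContinuousOn (fun r ↦ (p r : ℂ)⁻¹ • M + ((q r : ℂ) - l) • N) (Ioc 0 c) := by
    have hp' : ContinuousOn (fun r ↦ (p r : ℂ)) (Ioc 0 c) :=
      Complex.continuous_ofReal.comp_continuousOn hp
    have hq' : ContinuousOn (fun r ↦ (q r : ℂ)) (Ioc 0 c) :=
      Complex.continuous_ofReal.comp_continuousOn hq
    exact ((hp'.inv₀ fun r hr ↦ mod_cast hp0 r hr).smul continuousOn_const).add
      ((hq'.sub continuousOn_const).smul continuousOn_const)
  obtain ⟨u, hu0, hu⟩ := exists_linearODE_solution_Ioc hA (α, β)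
  refine ⟨fun r ↦ (u r).1, fun r ↦ (u r).2, congrArg Prod.fst (hu0 hc),
    congrArg Prod.snd (hu0 hc),
    fun r hr ↦ ?_, fun r hr ↦ ?_⟩
  · simpa [M, N, Function.comp_def] using
      (ContinuousLinearMap.fst ℝ ℂ ℂ).hasFDerivAt.comp_hasDerivWithinAt r (hu r hr)
  · simpa [M, N, Function.comp_def] using
      (ContinuousLinearMap.snd ℝ ℂ ℂ).hasFDerivAt.comp_hasDerivWithinAt r (hu r hr)

/-- A backward Grönwall inequality with an integrable coefficient, on a half-open interval. -/
lemma le_mul_exp_integral_of_neg_mul_le_deriv {a c : ℝ} {k N N' : ℝ → ℝ}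
    (hk : ContinuousOn k (Ioc a c)) (hki : IntegrableOn k (Ioc a c))
    (hk0 : ∀ r ∈ Ioc a c, 0 ≤ k r) (hN0 : 0 ≤ N c)
    (hN : ∀ r ∈ Ioc a c, HasDerivWithinAt N (N' r) (Ioc a c) r)
    (hN' : ∀ r ∈ Ioc a c, -(k r * N r) ≤ N' r) :
    ∀ r ∈ Ioc a c, N r ≤ N c * Real.exp (∫ s in Ioc a c, k s) := by
  intro r hr
  have hac : a ≤ c := hr.1.le.trans hr.2
  have hint : IntervalIntegrable k volume a c :=
    (intervalIntegrable_iff_integrableOn_Ioc_of_le hac).2 hki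
  set G : ℝ → ℝ := fun t ↦ ∫ s in c..t, k s with hG
  have hGc : ContinuousOn G (Ioc a c) :=
    (intervalIntegral.continuousOn_primitive_interval' hint right_mem_uIcc).mono
      (by rw [uIcc_of_le hac]; exact Ioc_subset_Icc_self)
  have hderiv : ∀ t ∈ Ioo a c, HasDerivAt (fun t ↦ N t * Real.exp (G t))
      (N' t * Real.exp (G t) + N t * (Real.exp (G t) * k t)) t := by
    intro t ht
    have hGt : HasDerivAt G (k t) t := by
      refine intervalIntegral.integral_hasDerivAt_right ?_ ?_
        (hk.continuousAt (Ioc_mem_nhds ht.1 ht.2))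
      · exact (hint.mono_set (uIcc_subset_uIcc right_mem_uIcc
          (by rw [uIcc_of_le hac]; exact Ioo_subset_Icc_self ht)))
      · exact (hk.mono Ioo_subset_Ioc_self).stronglyMeasurableAtFilter isOpen_Ioo t ht
    exact ((hN t (Ioo_subset_Ioc_self ht)).hasDerivAt (Ioc_mem_nhds ht.1 ht.2)).mul hGt.exp
  have hmono : MonotoneOn (fun t ↦ N t * Real.exp (G t)) (Ioc a c) := by
    refine monotoneOn_of_deriv_nonneg (convex_Ioc a c)
      (ContinuousOn.mul (fun t ht ↦ (hN t ht).continuousWithinAt) hGc.rexp) ?_ ?_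
    · rw [interior_Ioc]
      exact fun t ht ↦ (hderiv t ht).differentiableAt.differentiableWithinAt
    · rw [interior_Ioc]
      intro t ht
      rw [(hderiv t ht).deriv]
      nlinarith [hN' t (Ioo_subset_Ioc_self ht), Real.exp_pos (G t)]
  have h1 : N r * Real.exp (G r) ≤ N c := by
    simpa [hG] using hmono hr (right_mem_Ioc.2 (hr.1.trans_le hr.2)) hr.2
  have h2 : -G r ≤ ∫ s in Ioc a c, k s := by
    rw [hG, ← intervalIntegral.integral_symm, intervalIntegral.integral_of_le hr.2]
    exact setIntegral_mono_set hki ((ae_restrict_iff' measurableSet_Ioc).2 (ae_of_all _ hk0))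
      (Ioc_subset_Ioc_left hr.1.le).eventuallyLE
  calc N r = N r * Real.exp (G r) * Real.exp (-G r) := by
        rw [mul_assoc, ← Real.exp_add, add_neg_cancel, Real.exp_zero, mul_one]
    _ ≤ N c * Real.exp (∫ s in Ioc a c, k s) := by gcongr

/-- The Cauchy–Schwarz inequality in dimension two. -/
lemma add_mul_sq_le {a b s t : ℝ} :
    (a * s + b * t) ^ 2 ≤ (a ^ 2 + b ^ 2) * (s ^ 2 + t ^ 2) := by
  nlinarith [sq_nonneg (a * t - b * s)]

/-- If for some `l₀` every solution of `L x = l₀ x` on `(0, c]` is square integrable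
near the origin, then for every `l` every solution of `L x = l x` is square
integrable near the origin. -/
theorem limit_circle_invariance_at_origin
    (c : ℝ) (hc : 0 < c) (p q : ℝ → ℝ)
    (hq : ContinuousOn q (Ioc 0 c))
    (hp : ContDiffOn ℝ 1 p (Ioc 0 c))
    (hppos : ∀ r ∈ Ioc 0 c, 0 < p r)
    (l₀ : ℂ)
    (h₀ : ∀ x : ℝ → ℂ, IsSLSolution p q l₀ (Ioc 0 c) x →
      IntegrableOn (fun r => ‖x r‖ ^ 2) (Ioc 0 c) volume) :
    ∀ l : ℂ, ∀ x : ℝ → ℂ, IsSLSolution p q l (Ioc 0 c) x →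
      IntegrableOn (fun r => ‖x r‖ ^ 2) (Ioc 0 c) volume := by
  intro l x hx
  have hp0 : ∀ r ∈ Ioc 0 c, p r ≠ 0 := fun r hr ↦ (hppos r hr).ne'
  have hcmem : c ∈ Ioc 0 c := right_mem_Ioc.2 hc
  obtain ⟨y, hx', hy'⟩ := (isSLSolution_iff hp0).1 hx
  obtain ⟨φ, u, hφc, huc, hφ, hu⟩ :=
    exists_slSystem_solution_s1 hc hq hp.continuousOn hp0 l₀ 1 0
  obtain ⟨ψ, v, hψc, hvc, hψ, hv⟩ :=
    exists_slSystem_solution_s1 hc hq hp.continuousOn hp0 l₀ 0 1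
  have hφi := h₀ φ ((isSLSolution_iff hp0).2 ⟨u, hφ, hu⟩)
  have hψi := h₀ ψ ((isSLSolution_iff hp0).2 ⟨v, hψ, hv⟩)
  have hφcont : ContinuousOn φ (Ioc 0 c) := fun r hr ↦ (hφ r hr).continuousWithinAt
  have hψcont : ContinuousOn ψ (Ioc 0 c) := fun r hr ↦ (hψ r hr).continuousWithinAt
  have hxcont : ContinuousOn x (Ioc 0 c) := fun r hr ↦ (hx' r hr).continuousWithinAt
  have hwronskian : ∀ r ∈ Ioc 0 c, φ r * v r - ψ r * u r = 1 := by
    intro r hr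
    have hW : ∀ s ∈ Ioc 0 c,
        HasDerivWithinAt (fun s ↦ φ s * v s - ψ s * u s) 0 (Ioc 0 c) s := fun s hs ↦
      (((hφ s hs).mul (hv s hs)).sub ((hψ s hs).mul (hu s hs))).congr_deriv (by ring)
    have h := (convex_Ioc 0 c).norm_image_sub_le_of_norm_hasDerivWithin_le (C := 0) hW
      (fun _ _ ↦ by simp) hr hcmem
    rw [zero_mul, norm_le_zero_iff, sub_eq_zero] at h
    simpa [hφc, huc, hψc, hvc] using h.symm
  set W₁ : ℝ → ℂ := fun r ↦ x r * v r - y r * ψ r with hW₁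
  set W₂ : ℝ → ℂ := fun r ↦ φ r * y r - u r * x r with hW₂
  have hW₁' : ∀ r ∈ Ioc 0 c, HasDerivWithinAt W₁ ((l - l₀) * x r * ψ r) (Ioc 0 c) r :=
    fun r hr ↦ (((hx' r hr).mul (hv r hr)).sub ((hy' r hr).mul (hψ r hr))).congr_deriv (by ring)
  have hW₂' : ∀ r ∈ Ioc 0 c, HasDerivWithinAt W₂ (-((l - l₀) * x r * φ r)) (Ioc 0 c) r :=
    fun r hr ↦ (((hφ r hr).mul (hy' r hr)).sub ((hu r hr).mul (hx' r hr))).congr_deriv (by ring)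
  have hxW : ∀ r ∈ Ioc 0 c, x r = W₁ r * φ r + W₂ r * ψ r := by
    intro r hr
    simp only [hW₁, hW₂]
    linear_combination (-x r) * hwronskian r hr
  set H : ℝ → ℝ := fun r ↦ ‖φ r‖ ^ 2 + ‖ψ r‖ ^ 2 with hH
  set N : ℝ → ℝ := fun r ↦ ‖W₁ r‖ ^ 2 + ‖W₂ r‖ ^ 2 with hN
  have hHi : IntegrableOn H (Ioc 0 c) := hφi.add hψi
  have hHcont : ContinuousOn H (Ioc 0 c) := (hφcont.norm.pow 2).add (hψcont.norm.pow 2)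
  have hH0 : ∀ r, 0 ≤ H r := fun r ↦ by positivity
  have hN0 : ∀ r, 0 ≤ N r := fun r ↦ by positivity
  have hxle : ∀ r ∈ Ioc 0 c, ‖x r‖ ≤ ‖W₁ r‖ * ‖φ r‖ + ‖W₂ r‖ * ‖ψ r‖ := by
    intro r hr
    rw [hxW r hr, ← norm_mul, ← norm_mul]
    exact norm_add_le _ _
  have hxsq : ∀ r ∈ Ioc 0 c, ‖x r‖ ^ 2 ≤ N r * H r := fun r hr ↦
    (pow_le_pow_left₀ (norm_nonneg _) (hxle r hr) 2).trans add_mul_sq_le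
  have hbound := le_mul_exp_integral_of_neg_mul_le_deriv (k := fun r ↦ 2 * ‖l - l₀‖ * H r)
    (continuousOn_const.mul hHcont) (hHi.const_mul _) (fun r _ ↦ by positivity) (hN0 c)
    (fun r hr ↦ (hW₁' r hr).norm_sq.add (hW₂' r hr).norm_sq) (fun r hr ↦ by
      have h₁ := (abs_le.1 (abs_real_inner_le_norm (W₁ r) ((l - l₀) * x r * ψ r))).1
      have h₂ := (abs_le.1 (abs_real_inner_le_norm (W₂ r) (-((l - l₀) * x r * φ r)))).1
      rw [norm_mul, norm_mul] at h₁
      rw [norm_neg, norm_mul, norm_mul] at h₂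
      have h₃ : ‖x r‖ * (‖W₁ r‖ * ‖ψ r‖ + ‖W₂ r‖ * ‖φ r‖) ≤ N r * H r := by
        refine abs_le_of_sq_le_sq' ?_ (mul_nonneg (hN0 r) (hH0 r)) |>.2
        rw [mul_pow, sq (N r * H r)]
        refine mul_le_mul (hxsq r hr) ?_ (by positivity) (mul_nonneg (hN0 r) (hH0 r))
        exact add_mul_sq_le.trans_eq (by simp only [hN, hH]; ring)
      have h₄ := mul_le_mul_of_nonneg_left h₃ (norm_nonneg (l - l₀))
      linarith)
  have hdom : IntegrableOn
      (fun r ↦ N c * Real.exp (∫ s in Ioc 0 c, 2 * ‖l - l₀‖ * H s) * H r) (Ioc 0 c) :=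
    hHi.const_mul _
  refine hdom.mono' ((hxcont.norm.pow 2).aestronglyMeasurable measurableSet_Ioc)
    ((ae_restrict_iff' measurableSet_Ioc).2 (ae_of_all _ fun r hr ↦ ?_))
  rw [Real.norm_of_nonneg (by positivity)]
  exact (hxsq r hr).trans (mul_le_mul_of_nonneg_right (hbound r hr) (hH0 r))
end

section
/- Let c > 0, let p, q : ℝ → ℝ be continuous on [c, ∞) with p > 0 and p continuously differentiable, and let l ∈ ℂ with Im(l) ≠ 0. Suppose L is in the limit-point case at infinity, i.e. there exists a solution of Lx = lx on [c, ∞) that is not of class L²(c, ∞). Then there exists a solution χ of Lx = lx on [c, ∞) with χ not identically zero and χ of class L²(c, ∞), and any two solutions of Lx = lx of class L²(c, ∞) are linearly dependent over ℂ. -/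
open MeasureTheory Set Filter

/-- Global existence for linear differential equations with continuous coefficients. -/
theorem exists_forall_hasDerivAt_clm_apply {E : Type*} [NormedAddCommGroup E] [NormedSpace ℝ E]
    [CompleteSpace E] {A : ℝ → E →L[ℝ] E} (hA : Continuous A) (c : ℝ) (x₀ : E) :
    ∃ z : ℝ → E, z c = x₀ ∧ ∀ t ∈ Ici c, HasDerivAt z (A t (z t)) t := by
  have hk : Continuous fun t => ‖A t‖ := hA.norm
  set w : ℝ → ℝ := fun t => Real.exp (2 * ∫ s in c..t, ‖A s‖) with hw
  have hw' : ∀ t, HasDerivAt w (2 * (‖A t‖ * w t)) t := fun t => by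
    have h := (((hk.integral_hasStrictDerivAt c t).hasDerivAt).const_mul 2).exp
    convert h using 1
    simp only [hw]; ring
  have hwc : Continuous w := continuous_iff_continuousAt.2 fun t => (hw' t).continuousAt
  have hwpos : ∀ t, 0 < w t := fun t => Real.exp_pos _
  have hw_c : w c = 1 := by simp [hw]
  have hint : ∀ t, ∫ s in c..t, ‖A s‖ * w s = (w t - 1) / 2 := fun t => by
    have h := intervalIntegral.integral_eq_sub_of_hasDerivAt (a := c) (b := t)
      (fun s _ => hw' s) ((continuous_const.mul (hk.mul hwc)).intervalIntegrable _ _)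
    rw [intervalIntegral.integral_const_mul, hw_c] at h
    linarith
  have hw1 : ∀ t, c ≤ t → 1 ≤ w t := fun t ht => by
    refine Real.one_le_exp (mul_nonneg zero_le_two ?_)
    exact intervalIntegral.integral_nonneg ht fun s _ => norm_nonneg _
  have hcont : ∀ y : BoundedContinuousFunction ℝ E, Continuous fun s => w s • A s (y s) :=
    fun y => hwc.smul (hA.clm_apply y.continuous)
  have hbound : ∀ (y : BoundedContinuousFunction ℝ E) (t : ℝ), c ≤ t →
      ‖(w t)⁻¹ • ∫ s in c..t, w s • A s (y s)‖ ≤ 1 / 2 * ‖y‖ := fun y t ht => by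
    have h1 : ‖∫ s in c..t, w s • A s (y s)‖ ≤ ∫ s in c..t, ‖y‖ * (‖A s‖ * w s) := by
      refine intervalIntegral.norm_integral_le_of_norm_le ht (ae_of_all _ fun s _ => ?_)
        ((continuous_const.mul (hk.mul hwc)).intervalIntegrable _ _)
      rw [norm_smul, Real.norm_of_nonneg (hwpos s).le]
      calc w s * ‖A s (y s)‖ ≤ w s * (‖A s‖ * ‖y‖) :=
            mul_le_mul_of_nonneg_left ((A s).le_opNorm_of_le (y.norm_coe_le_norm s)) (hwpos s).le
        _ = _ := by ring
    rw [intervalIntegral.integral_const_mul, hint] at h1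
    rw [norm_smul, norm_inv, Real.norm_of_nonneg (hwpos t).le, inv_mul_le_iff₀ (hwpos t)]
    nlinarith [norm_nonneg y]
  have hmc : Continuous fun t : ℝ => max c t := continuous_const.max continuous_id
  let T : BoundedContinuousFunction ℝ E → BoundedContinuousFunction ℝ E := fun y =>
    BoundedContinuousFunction.ofNormedAddCommGroup
      (fun t => (w (max c t))⁻¹ • (x₀ + ∫ s in c..max c t, w s • A s (y s)))
      (((hwc.comp hmc).inv₀ fun t => (hwpos _).ne').smul (continuous_const.add
        ((intervalIntegral.continuous_primitive
          (fun a b => (hcont y).intervalIntegrable a b) c).comp hmc)))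
      (‖x₀‖ + 1 / 2 * ‖y‖) (fun t => by
        rw [smul_add]
        refine (norm_add_le _ _).trans (add_le_add ?_ (hbound y _ (le_max_left _ _)))
        rw [norm_smul, norm_inv, Real.norm_of_nonneg (hwpos _).le]
        exact mul_le_of_le_one_left (norm_nonneg _)
          (inv_le_one_of_one_le₀ (hw1 _ (le_max_left _ _))))
  have hT : ContractingWith (1 / 2) T := by
    refine ⟨by rw [← NNReal.coe_lt_coe]; norm_num, LipschitzWith.of_dist_le_mul fun y₁ y₂ => ?_⟩
    rw [BoundedContinuousFunction.dist_le (by positivity)]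
    intro t
    have h := hbound (y₁ - y₂) _ (le_max_left c t)
    rw [dist_eq_norm, dist_eq_norm]
    have e : T y₁ t - T y₂ t =
        (w (max c t))⁻¹ • ∫ s in c..max c t, w s • A s ((y₁ - y₂) s) := by
      change (w (max c t))⁻¹ • (x₀ + ∫ s in c..max c t, w s • A s (y₁ s)) -
        (w (max c t))⁻¹ • (x₀ + ∫ s in c..max c t, w s • A s (y₂ s)) = _
      rw [← smul_sub, add_sub_add_left_eq_sub, ← intervalIntegral.integral_sub
        ((hcont y₁).intervalIntegrable _ _) ((hcont y₂).intervalIntegrable _ _)]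
      simp [smul_sub]
    rw [e]
    simpa using h
  set y := hT.fixedPoint T
  have hy : ∀ t, c ≤ t → w t • y t = x₀ + ∫ s in c..t, w s • A s (y s) := fun t ht => by
    have h : T y t = y t := by rw [hT.fixedPoint_isFixedPt]
    change (w (max c t))⁻¹ • (x₀ + ∫ s in c..max c t, w s • A s (y s)) = y t at h
    rw [max_eq_right ht] at h
    rw [← h, smul_inv_smul₀ (hwpos t).ne']
  refine ⟨fun t => x₀ + ∫ s in c..t, w s • A s (y s), by simp, fun t ht => ?_⟩
  beta_reduce
  rw [← hy t ht, map_smul]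
  exact ((hcont y).integral_hasStrictDerivAt c t).hasDerivAt.const_add x₀

/-- `x` and `v = p x'` form a solution on `[c, ∞)` of the first-order system equivalent to
`-(p x')' + q x = l x`. -/
def IsSLPair (p q : ℝ → ℝ) (l : ℂ) (c : ℝ) (x v : ℝ → ℂ) : Prop :=
  ∀ r ∈ Ici c, HasDerivWithinAt x (v r / p r) (Ici c) r ∧
    HasDerivWithinAt v ((q r - l) * x r) (Ici c) r

section SLPair

variable {p q : ℝ → ℝ} {l : ℂ} {c : ℝ} {x v y w z u : ℝ → ℂ}

theorem isSLSolution_iff_exists_isSLPair (hppos : ∀ r ∈ Ici c, 0 < p r) :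
    IsSLSolution p q l (Ici c) x ↔ ∃ v, IsSLPair p q l c x v := by
  have hp0 : ∀ r ∈ Ici c, (p r : ℂ) ≠ 0 := fun r hr => by exact_mod_cast (hppos r hr).ne'
  constructor
  · rintro ⟨x', h1, h2⟩
    refine ⟨fun s => p s * x' s, fun r hr => ⟨?_, ?_⟩⟩
    · simpa only [mul_div_cancel_left₀ _ (hp0 r hr)] using h1 r hr
    · simpa only [sub_mul] using h2 r hr
  · rintro ⟨v, h⟩
    refine ⟨fun s => v s / p s, fun r hr => (h r hr).1, fun r hr => ?_⟩
    rw [← sub_mul]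
    exact (h r hr).2.congr_of_mem (fun s hs => mul_div_cancel₀ _ (hp0 s hs)) hr

theorem exists_isSLPair (hq : ContinuousOn q (Ici c)) (hp : ContinuousOn p (Ici c))
    (hppos : ∀ r ∈ Ici c, 0 < p r) (l x₀ v₀ : ℂ) :
    ∃ x v, IsSLPair p q l c x v ∧ x c = x₀ ∧ v c = v₀ := by
  have hm : Continuous fun t : ℝ => max c t := continuous_const.max continuous_id
  have hmem : ∀ t, max c t ∈ Ici c := fun t => le_max_left c t
  have hp' : Continuous fun t => ((p (max c t) : ℂ))⁻¹ :=
    (Complex.continuous_ofReal.comp (hp.comp_continuous hm hmem)).inv₀ fun t => by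
      exact Complex.ofReal_ne_zero.2 (hppos _ (hmem t)).ne'
  have hq' : Continuous fun t => (q (max c t) : ℂ) - l :=
    (Complex.continuous_ofReal.comp (hq.comp_continuous hm hmem)).sub continuous_const
  let F := ContinuousLinearMap.fst ℝ ℂ ℂ
  let S := ContinuousLinearMap.snd ℝ ℂ ℂ
  obtain ⟨z, hzc, hz⟩ := exists_forall_hasDerivAt_clm_apply
    ((hp'.smul (continuous_const (y := (ContinuousLinearMap.inl ℝ ℂ ℂ).comp S))).add
      (hq'.smul (continuous_const (y := (ContinuousLinearMap.inr ℝ ℂ ℂ).comp F)))) c (x₀, v₀)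
  refine ⟨fun t => (z t).1, fun t => (z t).2, fun r hr => ?_, by simp [hzc], by simp [hzc]⟩
  have h1 := (F.hasFDerivAt.comp_hasDerivAt r (hz r hr)).hasDerivWithinAt (s := Ici c)
  have h2 := (S.hasFDerivAt.comp_hasDerivAt r (hz r hr)).hasDerivWithinAt (s := Ici c)
  have hmr : max c r = r := max_eq_right hr
  constructor
  · exact h1.congr_deriv (by simp [F, S, hmr, div_eq_inv_mul])
  · exact h2.congr_deriv (by simp [F, S, hmr])

namespace IsSLPair

theorem continuousOn (h : IsSLPair p q l c x v) : ContinuousOn x (Ici c) :=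
  fun r hr => (h r hr).1.continuousWithinAt

theorem continuousOn_snd (h : IsSLPair p q l c x v) : ContinuousOn v (Ici c) :=
  fun r hr => (h r hr).2.continuousWithinAt

theorem add (h : IsSLPair p q l c x v) (h' : IsSLPair p q l c y w) :
    IsSLPair p q l c (fun r => x r + y r) (fun r => v r + w r) := fun r hr => by
  constructor
  · exact ((h r hr).1.add (h' r hr).1).congr_deriv (by ring)
  · exact ((h r hr).2.add (h' r hr).2).congr_deriv (by ring)

theorem const_mul (h : IsSLPair p q l c x v) (m : ℂ) :
    IsSLPair p q l c (fun r => m * x r) (fun r => m * v r) := fun r hr => by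
  constructor
  · exact ((h r hr).1.const_mul m).congr_deriv (by ring)
  · exact ((h r hr).2.const_mul m).congr_deriv (by ring)

theorem wronskian_eq (h : IsSLPair p q l c x v) (h' : IsSLPair p q l c y w) {r : ℝ}
    (hr : r ∈ Ici c) : x r * w r - y r * v r = x c * w c - y c * v c := by
  have hd : ∀ s ∈ Ici c, HasDerivWithinAt (fun s => x s * w s - y s * v s) 0 (Ici c) s := by
    intro s hs
    exact (((h s hs).1.mul (h' s hs).2).sub ((h' s hs).1.mul (h s hs).2)).congr_deriv (by ring)
  refine constant_of_has_deriv_right_zero (f := fun s => x s * w s - y s * v s) (b := r)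
    (fun s hs => (hd s hs.1).continuousWithinAt.mono Icc_subset_Ici_self)
    (fun s hs => (hd s hs.1).mono (Ici_subset_Ici.2 hs.1)) r ⟨hr, le_rfl⟩

theorem intervalIntegrable_sq (h : IsSLPair p q l c x v) {r : ℝ} (hr : c ≤ r) :
    IntervalIntegrable (fun s => ‖x s‖ ^ 2) volume c r :=
  ((h.continuousOn.mono Icc_subset_Ici_self).norm.pow 2).intervalIntegrable_of_Icc hr

theorem im_mul_conj_eq (h : IsSLPair p q l c x v) {r : ℝ} (hr : c ≤ r) :
    (v r * (starRingEnd ℂ) (x r)).im =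
      (v c * (starRingEnd ℂ) (x c)).im - l.im * ∫ s in c..r, ‖x s‖ ^ 2 := by
  have key := intervalIntegral.integral_eq_sub_of_hasDeriv_right_of_le hr
    (f := fun s => (v s * (starRingEnd ℂ) (x s)).im) (f' := fun s => -l.im * ‖x s‖ ^ 2)
    (Complex.continuous_im.comp_continuousOn
      ((h.continuousOn_snd.mul (Complex.continuous_conj.comp_continuousOn h.continuousOn)).mono
        Icc_subset_Ici_self))
    (fun s hs => by
      have hs' : s ∈ Ici c := hs.1.le
      have hx := (h s hs').1
      have hx' : HasDerivWithinAt (fun t => (starRingEnd ℂ) (x t))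
          ((starRingEnd ℂ) (v s / p s)) (Ici c) s :=
        Complex.conjCLE.hasFDerivAt.comp_hasDerivWithinAt s hx
      have hd := Complex.imCLM.hasFDerivAt.comp_hasDerivWithinAt s ((h s hs').2.mul hx')
      refine HasDerivWithinAt.mono ?_ ((Ioi_subset_Ioi hs.1.le).trans Ioi_subset_Ici_self)
      refine hd.congr_deriv ?_
      have e : v s * (starRingEnd ℂ) (v s / p s) = ((‖v s‖ ^ 2 / p s : ℝ) : ℂ) := by
        rw [map_div₀, Complex.conj_ofReal, ← mul_div_assoc, Complex.mul_conj']
        push_cast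
        rfl
      rw [e, mul_assoc, Complex.mul_conj']
      simp [← Complex.ofReal_pow])
    ((h.intervalIntegrable_sq hr).const_mul _)
  rw [intervalIntegral.integral_const_mul] at key
  linarith

theorem integral_sq_pos (h : IsSLPair p q l c x v)
    (hppos : ∀ r ∈ Ici c, 0 < p r) (hv : v c ≠ 0) {r : ℝ} (hr : c < r) :
    0 < ∫ s in c..r, ‖x s‖ ^ 2 := by
  have hc0 : ContinuousOn (fun s => ‖x s‖ ^ 2) (Icc c r) :=
    (h.continuousOn.mono Icc_subset_Ici_self).norm.pow 2
  suffices ∃ s ∈ Icc c r, 0 < ‖x s‖ ^ 2 from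
    intervalIntegral.integral_pos hr hc0 (fun _ _ => by positivity) this
  by_contra! hz
  have hx0 : ∀ s ∈ Icc c r, x s = 0 := fun s hs => by
    have := hz s hs
    have h2 : ‖x s‖ ^ 2 = 0 := le_antisymm this (by positivity)
    simpa using h2
  have hcm : c ∈ Icc c r := ⟨le_rfl, hr.le⟩
  have h1 := (h c self_mem_Ici).1.mono (Icc_subset_Ici_self : Icc c r ⊆ Ici c)
  have h2 : HasDerivWithinAt x 0 (Icc c r) c :=
    (hasDerivWithinAt_const c (Icc c r) (0 : ℂ)).congr_of_mem hx0 hcm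
  have h3 := (uniqueDiffOn_Icc hr c hcm).eq_deriv _ h1 h2
  have hp0 : (p c : ℂ) ≠ 0 := by exact_mod_cast (hppos c self_mem_Ici).ne'
  exact (div_ne_zero hv hp0) h3

theorem integrableOn_sq_of_bounded (h : IsSLPair p q l c x v) {C : ℝ}
    (hC : ∀ r, c ≤ r → ∫ s in c..r, ‖x s‖ ^ 2 ≤ C) :
    IntegrableOn (fun r => ‖x r‖ ^ 2) (Ioi c) := by
  refine integrableOn_Ioi_of_intervalIntegral_norm_bounded (ι := ℝ) (l := atTop) (b := id) C c
    (fun r => ?_) tendsto_id ?_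
  · rcases le_total c r with hr | hr
    · exact (intervalIntegrable_iff_integrableOn_Ioc_of_le hr).1 (h.intervalIntegrable_sq hr)
    · simp [Ioc_eq_empty_of_le hr]
  · filter_upwards [eventually_ge_atTop c] with r hr
    simpa using hC r hr

theorem integral_sq_add_le (h : IsSLPair p q l c x v) (h' : IsSLPair p q l c y w) {r : ℝ}
    (hr : c ≤ r) :
    ∫ s in c..r, ‖x s + y s‖ ^ 2 ≤
      2 * (∫ s in c..r, ‖x s‖ ^ 2) + 2 * ∫ s in c..r, ‖y s‖ ^ 2 := by
  rw [← intervalIntegral.integral_const_mul, ← intervalIntegral.integral_const_mul,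
    ← intervalIntegral.integral_add ((h.intervalIntegrable_sq hr).const_mul _)
      ((h'.intervalIntegrable_sq hr).const_mul _)]
  refine intervalIntegral.integral_mono_on hr ((h.add h').intervalIntegrable_sq hr)
    (((h.intervalIntegrable_sq hr).const_mul _).add
      ((h'.intervalIntegrable_sq hr).const_mul _)) fun s _ => ?_
  nlinarith [norm_add_le (x s) (y s), norm_nonneg (x s + y s), norm_nonneg (x s),
    norm_nonneg (y s), sq_nonneg (‖x s‖ - ‖y s‖)]

theorem integral_sq_const_mul (m : ℂ) (r : ℝ) :
    ∫ s in c..r, ‖m * x s‖ ^ 2 = ‖m‖ ^ 2 * ∫ s in c..r, ‖x s‖ ^ 2 := by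
  simp only [norm_mul, mul_pow, intervalIntegral.integral_const_mul]

theorem integrableOn_sq_add_mul (h : IsSLPair p q l c x v) (h' : IsSLPair p q l c y w)
    (hx : IntegrableOn (fun r => ‖x r‖ ^ 2) (Ioi c))
    (hy : IntegrableOn (fun r => ‖y r‖ ^ 2) (Ioi c)) (a b : ℂ) :
    IntegrableOn (fun r => ‖a * x r + b * y r‖ ^ 2) (Ioi c) := by
  have hbd : ∀ f : ℝ → ℂ, IntegrableOn (fun r => ‖f r‖ ^ 2) (Ioi c) → ∀ r, c ≤ r →
      ∫ s in c..r, ‖f s‖ ^ 2 ≤ ∫ s in Ioi c, ‖f s‖ ^ 2 := fun f hf r hr => by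
    rw [intervalIntegral.integral_of_le hr]
    exact setIntegral_mono_set hf (ae_of_all _ fun s => by positivity)
      Ioc_subset_Ioi_self.eventuallyLE
  refine ((h.const_mul a).add (h'.const_mul b)).integrableOn_sq_of_bounded
    (C := 2 * (‖a‖ ^ 2 * ∫ s in Ioi c, ‖x s‖ ^ 2) + 2 * (‖b‖ ^ 2 * ∫ s in Ioi c, ‖y s‖ ^ 2))
    fun r hr => ?_
  refine ((h.const_mul a).integral_sq_add_le (h'.const_mul b) hr).trans ?_
  rw [integral_sq_const_mul, integral_sq_const_mul]
  gcongr
  · exact hbd x hx r hr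
  · exact hbd y hy r hr

/-- Weyl's construction of a square-integrable combination of a fundamental system. -/
theorem exists_integrableOn_sq (hl : l.im ≠ 0) (hppos : ∀ r ∈ Ici c, 0 < p r)
    (hu : IsSLPair p q l c u w) (hv : IsSLPair p q l c x v)
    (huc : u c = 1) (hwc : w c = 0) (hxc : x c = 0) (hvc : v c = 1) :
    ∃ m : ℂ, IntegrableOn (fun r => ‖u r + m * x r‖ ^ 2) (Ioi c) := by
  have hpos : ∀ r, c < r → 0 < ∫ s in c..r, ‖x s‖ ^ 2 := fun r hr =>
    hv.integral_sq_pos hppos (by simp [hvc]) hr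
  have hdisk : ∀ r, c < r → ∃ m : ℂ, ∫ s in c..r, ‖u s + m * x s‖ ^ 2 ≤ ‖m‖ / |l.im| := by
    intro r hr
    have hxr : x r ≠ 0 := fun h0 => by
      have h1 := hv.im_mul_conj_eq hr.le
      simp only [h0, hxc, map_zero, mul_zero, Complex.zero_im, zero_sub] at h1
      exact mul_ne_zero hl (hpos r hr).ne' (by linarith)
    refine ⟨-u r / x r, ?_⟩
    have h1 := (hu.add (hv.const_mul (-u r / x r))).im_mul_conj_eq hr.le
    simp only [div_mul_cancel₀ _ hxr, add_neg_cancel, map_zero, mul_zero, Complex.zero_im,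
      huc, hwc, hxc, hvc, add_zero, zero_add, mul_one, map_one] at h1
    have h2 : ∫ s in c..r, ‖u s + -u r / x r * x s‖ ^ 2 = (-u r / x r).im / l.im := by
      rw [eq_div_iff hl]
      linarith
    rw [h2]
    refine (le_abs_self _).trans ?_
    rw [abs_div]
    gcongr
    exact Complex.abs_im_le_norm _
  choose! m hm using hdisk
  set A := ∫ s in c..(c + 1), ‖u s‖ ^ 2
  set B := ∫ s in c..(c + 1), ‖x s‖ ^ 2
  have hB : 0 < B := hpos _ (by linarith)
  have hl' : 0 < |l.im| := abs_pos.2 hl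
  have hA : 0 ≤ A := intervalIntegral.integral_nonneg (by linarith) fun s _ => by positivity
  have hmono : ∀ (n : ℂ) (r t : ℝ), c ≤ r → r ≤ t →
      ∫ s in c..r, ‖u s + n * x s‖ ^ 2 ≤ ∫ s in c..t, ‖u s + n * x s‖ ^ 2 :=
    fun n r t hr hrt => intervalIntegral.integral_mono_interval le_rfl hr hrt
      (ae_of_all _ fun s => by positivity)
      ((hu.add (hv.const_mul n)).intervalIntegrable_sq (hr.trans hrt))
  have hbdd : ∀ r, c + 1 ≤ r → ‖m r‖ ≤ 1 + (2 / |l.im| + 2 * A) / B := by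
    intro r hr
    have h1 := (hmono (m r) (c + 1) r (by linarith) hr).trans (hm r (by linarith))
    have h2 := (hu.add (hv.const_mul (m r))).integral_sq_add_le (hu.const_mul (-1))
      (r := c + 1) (by linarith)
    have h3 : ∀ s, u s + m r * x s + -1 * u s = m r * x s := fun s => by ring
    simp only [h3] at h2
    rw [integral_sq_const_mul, integral_sq_const_mul] at h2
    have h4 : ‖m r‖ ^ 2 * B ≤ ‖m r‖ * (2 / |l.im|) + 2 * A := by
      have : ‖m r‖ * (2 / |l.im|) = 2 * (‖m r‖ / |l.im|) := by ring
      rw [this]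
      norm_num at h2
      linarith
    rcases le_total ‖m r‖ 1 with h5 | h5
    · have : 0 ≤ (2 / |l.im| + 2 * A) / B := by positivity
      linarith
    · have h6 : ‖m r‖ * (‖m r‖ * B) ≤ ‖m r‖ * (2 / |l.im| + 2 * A) := by nlinarith
      have h7 : ‖m r‖ ≤ (2 / |l.im| + 2 * A) / B :=
        (le_div_iff₀ hB).2 (le_of_mul_le_mul_left h6 (by linarith))
      linarith
  set R := 1 + (2 / |l.im| + 2 * A) / B
  obtain ⟨m₀, -, φ, hφ, hlim⟩ := tendsto_subseq_of_bounded
    (Metric.isBounded_closedBall (x := (0 : ℂ)) (r := R))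
    (x := fun k : ℕ => m (c + 1 + k)) fun k => by
      simpa using hbdd (c + 1 + k) (by linarith [k.cast_nonneg (α := ℝ)])
  refine ⟨m₀, (hu.add (hv.const_mul m₀)).integrableOn_sq_of_bounded (C := 2 * (R / |l.im|))
    fun r hr => ?_⟩
  have hlim' : Tendsto (fun k => 2 * (R / |l.im|) +
      2 * (‖m₀ - m (c + 1 + φ k)‖ ^ 2 * ∫ s in c..r, ‖x s‖ ^ 2)) atTop
      (nhds (2 * (R / |l.im|))) := by
    have := (((tendsto_const_nhds (x := m₀)).sub hlim).norm.pow 2).mul_const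
      (∫ s in c..r, ‖x s‖ ^ 2)
    simpa using (this.const_mul 2).const_add (2 * (R / |l.im|))
  refine ge_of_tendsto hlim' ?_
  have hN : Tendsto (fun k => c + 1 + (φ k : ℝ)) atTop atTop :=
    tendsto_atTop_add_const_left _ _ (tendsto_natCast_atTop_atTop.comp hφ.tendsto_atTop)
  filter_upwards [hN.eventually_ge_atTop r] with k hk
  have hk1 : c + 1 ≤ c + 1 + (φ k : ℝ) := by linarith [(φ k).cast_nonneg (α := ℝ)]
  have h1 := (hu.add (hv.const_mul (m (c + 1 + φ k)))).integral_sq_add_le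
    (hv.const_mul (m₀ - m (c + 1 + φ k))) hr
  have h2 : ∀ s, u s + m (c + 1 + φ k) * x s + (m₀ - m (c + 1 + φ k)) * x s = u s + m₀ * x s :=
    fun s => by ring
  simp only [h2] at h1
  rw [integral_sq_const_mul] at h1
  refine h1.trans ?_
  gcongr
  refine ((hmono _ _ _ hr hk).trans (hm _ (by linarith))).trans ?_
  gcongr
  exact hbdd _ hk1

end IsSLPair

end SLPair

/-- In the limit-point case at infinity, for `Im l ≠ 0` there is a nontrivial
square-integrable solution of `L x = l x` on `[c, ∞)`, and any two square-integrable
solutions are linearly dependent over `ℂ`. -/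
theorem limit_point_unique_L2_solution_at_infinity
    (c : ℝ) (hc : 0 < c) (p q : ℝ → ℝ)
    (hq : ContinuousOn q (Ici c))
    (hp : ContDiffOn ℝ 1 p (Ici c))
    (hppos : ∀ r ∈ Ici c, 0 < p r)
    (l : ℂ) (hl : l.im ≠ 0)
    (hlp : ∃ x : ℝ → ℂ, IsSLSolution p q l (Ici c) x ∧
      ¬ IntegrableOn (fun r => ‖x r‖ ^ 2) (Ioi c) volume) :
    (∃ χ : ℝ → ℂ, IsSLSolution p q l (Ici c) χ ∧ (∃ r ∈ Ici c, χ r ≠ 0) ∧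
      IntegrableOn (fun r => ‖χ r‖ ^ 2) (Ioi c) volume) ∧
    (∀ x y : ℝ → ℂ,
      IsSLSolution p q l (Ici c) x → IntegrableOn (fun r => ‖x r‖ ^ 2) (Ioi c) volume →
      IsSLSolution p q l (Ici c) y → IntegrableOn (fun r => ‖y r‖ ^ 2) (Ioi c) volume →
      ∃ α β : ℂ, ¬(α = 0 ∧ β = 0) ∧ ∀ r ∈ Ici c, α * x r + β * y r = 0) := by
  have hpc := hp.continuousOn
  obtain ⟨u, w, hu, huc, hwc⟩ := exists_isSLPair hq hpc hppos l 1 0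
  obtain ⟨f, g, hf, hfc, hgc⟩ := exists_isSLPair hq hpc hppos l 0 1
  constructor
  · obtain ⟨m, hm⟩ := IsSLPair.exists_integrableOn_sq hl hppos hu hf huc hwc hfc hgc
    exact ⟨_, (isSLSolution_iff_exists_isSLPair hppos).2 ⟨_, hu.add (hf.const_mul m)⟩,
      ⟨c, self_mem_Ici, by simp [huc, hfc]⟩, hm⟩
  intro x y hx hxi hy hyi
  obtain ⟨z, hz, hzi⟩ := hlp
  obtain ⟨v, hv⟩ := (isSLSolution_iff_exists_isSLPair hppos).1 hx
  obtain ⟨t, ht⟩ := (isSLSolution_iff_exists_isSLPair hppos).1 hy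
  obtain ⟨s, hs⟩ := (isSLSolution_iff_exists_isSLPair hppos).1 hz
  have hD : x c * t c - y c * v c = 0 := by
    by_contra hD
    refine hzi ((hv.integrableOn_sq_add_mul ht hxi hyi
      ((z c * t c - y c * s c) / (x c * t c - y c * v c))
      ((x c * s c - z c * v c) / (x c * t c - y c * v c))).congr_fun
      (fun r hr => ?_) measurableSet_Ioi)
    have hr' : r ∈ Ici c := Ioi_subset_Ici_self hr
    have h1 := hv.wronskian_eq ht hr'
    have h2 := hs.wronskian_eq ht hr'
    have h3 := hv.wronskian_eq hs hr'
    have : (z c * t c - y c * s c) / (x c * t c - y c * v c) * x r +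
        (x c * s c - z c * v c) / (x c * t c - y c * v c) * y r = z r := by
      rw [div_mul_eq_mul_div, div_mul_eq_mul_div, ← add_div, div_eq_iff hD, ← h1, ← h2, ← h3]
      ring
    simp only [this]
  have hrep : ∀ x v : ℝ → ℂ, IsSLPair p q l c x v → ∀ r ∈ Ici c,
      x r = x c * u r + v c * f r := fun x v hv r hr => by
    have h1 := hv.wronskian_eq hf hr
    have h2 := hu.wronskian_eq hv hr
    have h3 := hu.wronskian_eq hf hr
    rw [hfc, hgc] at h1
    rw [huc, hwc] at h2
    rw [huc, hwc, hfc, hgc] at h3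
    linear_combination (-x r) * h3 + u r * h1 + f r * h2
  by_cases h0 : x c = 0 ∧ y c = 0
  · by_cases h1 : v c = 0
    · refine ⟨1, 0, by simp, fun r hr => ?_⟩
      rw [hrep x v hv r hr, h0.1, h1]
      ring
    · refine ⟨t c, -v c, by simp [h1], fun r hr => ?_⟩
      rw [hrep x v hv r hr, hrep y t ht r hr, h0.1, h0.2]
      ring
  · refine ⟨y c, -x c, fun h => h0 ⟨neg_eq_zero.1 h.2, h.1⟩, fun r hr => ?_⟩
    rw [hrep x v hv r hr, hrep y t ht r hr]
    linear_combination (-f r) * hD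
end

section
/- Let c > 0, let p, q : ℝ → ℝ be continuous on (0, c] with p > 0 and p continuously differentiable, and let l ∈ ℂ with Im(l) ≠ 0. Suppose L is in the limit-point case at the origin, i.e. there exists a solution of Lx = lx on (0, c] that is not of class L²(0, c). Then there exists a solution χ of Lx = lx on (0, c] with χ not identically zero and χ of class L²(0, c), and any two solutions of Lx = lx of class L²(0, c) are linearly dependent over ℂ. -/
open MeasureTheory Set Filter

section LinearODE

variable {𝕜 E : Type*} [NontriviallyNormedField 𝕜] [NormedAddCommGroup E] [NormedSpace 𝕜 E]
  {A : ℝ → E →L[𝕜] E} {a b : ℝ}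

lemma exists_nnnorm_bound_of_continuousOn_Icc (hA : ContinuousOn A (Icc a b)) :
    ∃ M : NNReal, ∀ t ∈ Icc a b, ‖A t‖ ≤ M := by
  obtain ⟨M, hM⟩ := isCompact_Icc.exists_bound_of_continuousOn hA
  exact ⟨M.toNNReal, fun t ht => (hM t ht).trans (Real.le_coe_toNNReal M)⟩

variable [NormedSpace ℝ E]

/-- The radial retraction of a normed space onto the closed ball of radius `R`. -/
noncomputable def radialRetraction (R : ℝ) (v : E) : E := (R / max R ‖v‖) • v

lemma norm_radialRetraction_le_norm {R : ℝ} (hR : 0 < R) (v : E) :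
    ‖radialRetraction R v‖ ≤ ‖v‖ := by
  have hm : 0 < max R ‖v‖ := lt_max_of_lt_left hR
  rw [radialRetraction, norm_smul, Real.norm_of_nonneg (by positivity)]
  exact mul_le_of_le_one_left (norm_nonneg v) ((div_le_one hm).2 (le_max_left _ _))

lemma norm_radialRetraction_le {R : ℝ} (hR : 0 < R) (v : E) :
    ‖radialRetraction R v‖ ≤ R := by
  have hm : 0 < max R ‖v‖ := lt_max_of_lt_left hR
  rw [radialRetraction, norm_smul, Real.norm_of_nonneg (by positivity), div_mul_eq_mul_div,
    div_le_iff₀ hm]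
  exact mul_le_mul_of_nonneg_left (le_max_right _ _) hR.le

lemma radialRetraction_of_norm_le {R : ℝ} (hR : 0 < R) {v : E} (hv : ‖v‖ ≤ R) :
    radialRetraction R v = v := by
  rw [radialRetraction, max_eq_left hv, div_self hR.ne', one_smul]

lemma norm_radialRetraction_sub_le_s4 {R : ℝ} (hR : 0 < R) (v w : E) :
    ‖radialRetraction R v - radialRetraction R w‖ ≤ 2 * ‖v - w‖ := by
  set m := max R ‖v‖ with hm
  set n := max R ‖w‖ with hn
  have hm0 : 0 < m := lt_max_of_lt_left hR
  have hn0 : 0 < n := lt_max_of_lt_left hR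
  have key : radialRetraction R v - radialRetraction R w
      = (R / n) • (v - w) + (R / n * ((n - m) / m)) • v := by
    have h : R / m = R / n + R / n * ((n - m) / m) := by field_simp; ring
    rw [radialRetraction, radialRetraction, ← hm, ← hn, h]
    module
  have hRn : R / n ≤ 1 := (div_le_one hn0).2 (le_max_left _ _)
  have hRn0 : 0 ≤ R / n := by positivity
  have hnm : |n - m| ≤ ‖v - w‖ := by
    rw [abs_sub_comm]
    refine (abs_max_sub_max_le_max R ‖v‖ R ‖w‖).trans ?_
    simpa using abs_norm_sub_norm_le v w
  have hvm : ‖v‖ / m ≤ 1 := (div_le_one hm0).2 (le_max_right _ _)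
  have h1 : ‖(R / n) • (v - w)‖ ≤ ‖v - w‖ := by
    rw [norm_smul, Real.norm_of_nonneg hRn0]
    exact mul_le_of_le_one_left (norm_nonneg _) hRn
  have h2 : ‖(R / n * ((n - m) / m)) • v‖ ≤ ‖v - w‖ := by
    rw [norm_smul, norm_mul, Real.norm_of_nonneg hRn0, norm_div, Real.norm_of_nonneg hm0.le,
      Real.norm_eq_abs]
    calc R / n * (|n - m| / m) * ‖v‖ = R / n * (|n - m| * (‖v‖ / m)) := by ring
      _ ≤ 1 * (‖v - w‖ * 1) := by gcongr
      _ = ‖v - w‖ := by ring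
  rw [key]
  linarith [norm_add_le ((R / n) • (v - w)) ((R / n * ((n - m) / m)) • v)]

/-- Uniqueness for a linear ODE on a compact interval, given the value on the right. -/
lemma eqOn_of_hasDerivWithinAt_linear (hA : ContinuousOn A (Icc a b)) {u v : ℝ → E}
    (hu : ∀ t ∈ Icc a b, HasDerivWithinAt u (A t (u t)) (Icc a b) t)
    (hv : ∀ t ∈ Icc a b, HasDerivWithinAt v (A t (v t)) (Icc a b) t)
    (huv : u b = v b) : EqOn u v (Icc a b) := by
  obtain ⟨M, hM⟩ := exists_nnnorm_bound_of_continuousOn_Icc hA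
  refine ODE_solution_unique_of_mem_Icc_left (v := fun t w => A t w) (s := fun _ => univ) (K := M)
    (fun t ht => LipschitzOnWith.of_dist_le_mul fun w _ z _ => ?_)
    (fun s hs => (hu s hs).continuousWithinAt)
    (fun s hs => (hu s (Ioc_subset_Icc_self hs)).mono_of_mem_nhdsWithin
      (Icc_mem_nhdsLE_of_mem hs)) (fun _ _ => mem_univ _)
    (fun s hs => (hv s hs).continuousWithinAt)
    (fun s hs => (hv s (Ioc_subset_Icc_self hs)).mono_of_mem_nhdsWithin
      (Icc_mem_nhdsLE_of_mem hs)) (fun _ _ => mem_univ _) huv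
  rw [dist_eq_norm, dist_eq_norm, ← map_sub]
  exact ((A t).le_opNorm _).trans
    (mul_le_mul_of_nonneg_right (hM t (Ioc_subset_Icc_self ht)) (norm_nonneg _))

/-- Uniqueness for a linear ODE on a half-open interval, given the value on the right. -/
lemma eqOn_Ioc_of_hasDerivWithinAt_linear (hA : ContinuousOn A (Ioc a b)) {u v : ℝ → E}
    (hu : ∀ t ∈ Ioc a b, HasDerivWithinAt u (A t (u t)) (Ioc a b) t)
    (hv : ∀ t ∈ Ioc a b, HasDerivWithinAt v (A t (v t)) (Ioc a b) t)
    (huv : u b = v b) : EqOn u v (Ioc a b) := fun t ht => by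
  have hsub : Icc t b ⊆ Ioc a b := fun s hs => ⟨ht.1.trans_le hs.1, hs.2⟩
  exact eqOn_of_hasDerivWithinAt_linear (hA.mono hsub)
    (fun s hs => (hu s (hsub hs)).mono hsub) (fun s hs => (hv s (hsub hs)).mono hsub) huv
    (left_mem_Icc.2 ht.2)

variable [CompleteSpace E]

/-- Global existence for a linear ODE on a compact interval, initial value on the left. -/
lemma exists_hasDerivWithinAt_linear_left (hab : a ≤ b) (hA : ContinuousOn A (Icc a b)) (u₀ : E) :
    ∃ u : ℝ → E, u a = u₀ ∧
      ∀ t ∈ Icc a b, HasDerivWithinAt u (A t (u t)) (Icc a b) t := by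
  obtain ⟨M, hM⟩ := exists_nnnorm_bound_of_continuousOn_Icc hA
  obtain ⟨R, hRdef⟩ : ∃ R : NNReal, (R : ℝ) = ‖u₀‖ * Real.exp (M * (b - a)) + 1 :=
    ⟨⟨_, by positivity⟩, rfl⟩
  have hR : 0 < (R : ℝ) := by rw [hRdef]; positivity
  have hba : 0 ≤ b - a := sub_nonneg.2 hab
  have hPL : IsPicardLindelof (fun t v => A t (radialRetraction (R : ℝ) v))
      (⟨a, left_mem_Icc.2 hab⟩ : Icc a b) u₀ (M * R * (b - a).toNNReal) 0 (M * R) (M * 2) := by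
    refine ⟨fun t ht => LipschitzOnWith.of_dist_le_mul fun v _ w _ => ?_, fun v _ => ?_,
      fun t ht v _ => ?_, ?_⟩
    · rw [dist_eq_norm, dist_eq_norm, ← map_sub]
      refine ((A t).le_opNorm _).trans ?_
      push_cast
      rw [mul_assoc]
      exact mul_le_mul (hM t ht) (norm_radialRetraction_sub_le_s4 hR v w) (norm_nonneg _) M.2
    · exact hA.clm_apply continuousOn_const
    · refine ((A t).le_opNorm _).trans ?_
      push_cast
      exact mul_le_mul (hM t ht) (norm_radialRetraction_le hR v) (norm_nonneg _) M.2
    · simp [hba]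
  obtain ⟨u, hua, hu⟩ := hPL.exists_eq_forall_mem_Icc_hasDerivWithinAt₀
  have hbound : ∀ t ∈ Icc a b, ‖u t‖ ≤ R := fun t ht => by
    have h := norm_le_gronwallBound_of_norm_deriv_right_le (K := M) (ε := 0) (δ := ‖u₀‖)
      (fun s hs => (hu s hs).continuousWithinAt)
      (fun s hs => (hu s (Ico_subset_Icc_self hs)).mono_of_mem_nhdsWithin
        (Icc_mem_nhdsGE_of_mem hs)) (by rw [← hua])
      (fun s hs => by
        rw [add_zero]
        exact ((A s).le_opNorm _).trans (mul_le_mul (hM s (Ico_subset_Icc_self hs))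
          (norm_radialRetraction_le_norm hR _) (norm_nonneg _) M.2)) t ht
    rw [gronwallBound_ε0] at h
    refine h.trans ?_
    have h' : ‖u₀‖ * Real.exp (M * (t - a)) ≤ ‖u₀‖ * Real.exp (M * (b - a)) := by
      gcongr
      exact ht.2
    linarith
  refine ⟨u, hua, fun t ht => ?_⟩
  have h := hu t ht
  rwa [radialRetraction_of_norm_le hR (hbound t ht)] at h

/-- Global existence for a linear ODE on a compact interval, initial value on the right. -/
lemma exists_hasDerivWithinAt_linear_right (hab : a ≤ b) (hA : ContinuousOn A (Icc a b))
    (u₀ : E) :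
    ∃ u : ℝ → E, u b = u₀ ∧
      ∀ t ∈ Icc a b, HasDerivWithinAt u (A t (u t)) (Icc a b) t := by
  have hmaps : MapsTo (fun t : ℝ => -t) (Icc (-b) (-a)) (Icc a b) := fun t ht =>
    ⟨by linarith [ht.2], by linarith [ht.1]⟩
  have hmaps' : MapsTo (fun t : ℝ => -t) (Icc a b) (Icc (-b) (-a)) := fun t ht =>
    ⟨by linarith [ht.2], by linarith [ht.1]⟩
  obtain ⟨u, hu₀, hu⟩ := exists_hasDerivWithinAt_linear_left (A := fun t => -A (-t))
    (neg_le_neg hab) (hA.comp continuous_neg.continuousOn hmaps).neg u₀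
  refine ⟨fun t => u (-t), hu₀, fun t ht => ?_⟩
  have h := (hu (-t) (hmaps' ht)).scomp t (hasDerivAt_neg t).hasDerivWithinAt hmaps'
  simpa [Function.comp_def] using h

/-- Global existence for a linear ODE on a half-open interval, initial value on the right. -/
lemma exists_hasDerivWithinAt_linear_Ioc (hab : a < b) (hA : ContinuousOn A (Ioc a b)) (u₀ : E) :
    ∃ u : ℝ → E, u b = u₀ ∧
      ∀ t ∈ Ioc a b, HasDerivWithinAt u (A t (u t)) (Ioc a b) t := by
  have hsub : ∀ s ∈ Ioc a b, Icc s b ⊆ Ioc a b := fun s hs r hr => ⟨hs.1.trans_le hr.1, hr.2⟩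
  have hex : ∀ s ∈ Ioc a b, ∃ u : ℝ → E, u b = u₀ ∧
      ∀ t ∈ Icc s b, HasDerivWithinAt u (A t (u t)) (Icc s b) t := fun s hs =>
    exists_hasDerivWithinAt_linear_right hs.2 (hA.mono (hsub s hs)) u₀
  choose! U hUb hU using hex
  have hagree : ∀ s ∈ Ioc a b, ∀ r ∈ Ioc a b, ∀ t ∈ Icc s b, t ∈ Icc r b → U s t = U r t := by
    intro s hs r hr t hts htr
    have h1 : Icc t b ⊆ Icc s b := Icc_subset_Icc_left hts.1
    have h2 : Icc t b ⊆ Icc r b := Icc_subset_Icc_left htr.1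
    exact eqOn_of_hasDerivWithinAt_linear (hA.mono (h1.trans (hsub s hs)))
      (fun x hx => (hU s hs x (h1 hx)).mono h1) (fun x hx => (hU r hr x (h2 hx)).mono h2)
      ((hUb s hs).trans (hUb r hr).symm) (left_mem_Icc.2 hts.2)
  have hb : b ∈ Ioc a b := right_mem_Ioc.2 hab
  refine ⟨fun t => U t t, hUb b hb, fun t ht => ?_⟩
  obtain ⟨s, has, hst⟩ := exists_between ht.1
  have hs : s ∈ Ioc a b := ⟨has, hst.le.trans ht.2⟩
  have heq : ∀ r ∈ Icc s b, U r r = U s r := fun r hr =>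
    hagree r (hsub s hs hr) s hs r (left_mem_Icc.2 hr.2) hr
  have hmem : Icc s b ∈ nhdsWithin t (Ioc a b) := by
    filter_upwards [self_mem_nhdsWithin, mem_nhdsWithin_of_mem_nhds (Ioi_mem_nhds hst)]
      with r hr hr' using ⟨le_of_lt hr', hr.2⟩
  have htm : t ∈ Icc s b := ⟨hst.le, ht.2⟩
  have h := ((hU s hs t htm).congr heq (heq t htm)).mono_of_mem_nhdsWithin hmem
  rwa [← heq t htm] at h

end LinearODE

/-- The first-order system, in the unknowns `(x, p x')`, equivalent to `-(p x')' + q x = l x`. -/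
noncomputable def slSystem (p q : ℝ → ℝ) (l : ℂ) (t : ℝ) : ℂ × ℂ →L[ℂ] ℂ × ℂ :=
  (p t : ℂ)⁻¹ • (ContinuousLinearMap.inl ℂ ℂ ℂ ∘L ContinuousLinearMap.snd ℂ ℂ ℂ) +
    ((q t : ℂ) - l) • (ContinuousLinearMap.inr ℂ ℂ ℂ ∘L ContinuousLinearMap.fst ℂ ℂ ℂ)

section SturmLiouville

variable {p q : ℝ → ℝ} {l : ℂ} {I : Set ℝ} {v : ℝ → ℂ × ℂ} {a b c : ℝ}

lemma slSystem_apply (t : ℝ) (w : ℂ × ℂ) :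
    slSystem p q l t w = (w.2 / p t, q t * w.1 - l * w.1) := by
  ext <;> simp [slSystem, div_eq_inv_mul, sub_mul]

lemma continuousOn_slSystem (hp : ContinuousOn p I) (hq : ContinuousOn q I)
    (hpne : ∀ r ∈ I, p r ≠ 0) : ContinuousOn (slSystem p q l) I := by
  have hp' : ContinuousOn (fun t => (p t : ℂ)⁻¹) I :=
    (Complex.continuous_ofReal.comp_continuousOn hp).inv₀
      fun r hr => Complex.ofReal_ne_zero.2 (hpne r hr)
  have hq' : ContinuousOn (fun t => (q t : ℂ) - l) I :=
    (Complex.continuous_ofReal.comp_continuousOn hq).sub continuousOn_const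
  exact (hp'.smul continuousOn_const).add (hq'.smul continuousOn_const)

lemma HasDerivWithinAt.fst_slSystem {t : ℝ}
    (h : HasDerivWithinAt v (slSystem p q l t (v t)) I t) :
    HasDerivWithinAt (fun s => (v s).1) ((v t).2 / p t) I t := by
  rw [slSystem_apply] at h
  exact (ContinuousLinearMap.fst ℝ ℂ ℂ).hasFDerivAt.comp_hasDerivWithinAt t h

lemma HasDerivWithinAt.snd_slSystem {t : ℝ}
    (h : HasDerivWithinAt v (slSystem p q l t (v t)) I t) :
    HasDerivWithinAt (fun s => (v s).2) (q t * (v t).1 - l * (v t).1) I t := by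
  rw [slSystem_apply] at h
  exact (ContinuousLinearMap.snd ℝ ℂ ℂ).hasFDerivAt.comp_hasDerivWithinAt t h

lemma isSLSolution_iff_exists_slSystem (hpne : ∀ r ∈ I, p r ≠ 0) {x : ℝ → ℂ} :
    IsSLSolution p q l I x ↔ ∃ v : ℝ → ℂ × ℂ, (∀ t, (v t).1 = x t) ∧
      ∀ t ∈ I, HasDerivWithinAt v (slSystem p q l t (v t)) I t := by
  constructor
  · rintro ⟨x', hx, hx'⟩
    refine ⟨fun t => (x t, p t * x' t), fun t => rfl, fun t ht => ?_⟩
    have h := (hx t ht).prodMk (hx' t ht)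
    have hpt : (p t : ℂ) ≠ 0 := Complex.ofReal_ne_zero.2 (hpne t ht)
    rwa [slSystem_apply, mul_div_cancel_left₀ _ hpt]
  · rintro ⟨v, hvx, hv⟩
    obtain rfl : (fun t => (v t).1) = x := funext hvx
    refine ⟨fun t => (v t).2 / p t, fun t ht => (hv t ht).fst_slSystem, fun t ht => ?_⟩
    have heq : ∀ s ∈ I, (p s : ℂ) * ((v s).2 / p s) = (v s).2 := fun s hs =>
      mul_div_cancel₀ _ (Complex.ofReal_ne_zero.2 (hpne s hs))
    exact (hv t ht).snd_slSystem.congr heq (heq t ht)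

lemma HasDerivWithinAt.slSystem_smul_add_smul {w : ℝ → ℂ × ℂ} {t : ℝ}
    (hv : HasDerivWithinAt v (slSystem p q l t (v t)) I t)
    (hw : HasDerivWithinAt w (slSystem p q l t (w t)) I t) (α β : ℂ) :
    HasDerivWithinAt (fun s => α • v s + β • w s) (slSystem p q l t (α • v t + β • w t)) I t := by
  rw [map_add, map_smul, map_smul]
  exact (hv.const_smul α).add (hw.const_smul β)

/-- Green's identity for a solution paired with its conjugate. -/
lemma integral_normSq_slSystem (hab : a ≤ b)
    (hv : ∀ t ∈ Icc a b, HasDerivWithinAt v (slSystem p q l t (v t)) (Icc a b) t) :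
    l.im * ∫ t in a..b, ‖(v t).1‖ ^ 2 =
      ((v a).2 * star (v a).1).im - ((v b).2 * star (v b).1).im := by
  have hvc : ContinuousOn v (Icc a b) := fun t ht => (hv t ht).continuousWithinAt
  have hderiv : ∀ t ∈ Icc a b, HasDerivWithinAt (fun s => ((v s).2 * star (v s).1).im)
      (-(l.im * ‖(v t).1‖ ^ 2)) (Icc a b) t := fun t ht => by
    have h := Complex.imCLM.hasFDerivAt.comp_hasDerivWithinAt t
      ((hv t ht).snd_slSystem.mul (hv t ht).fst_slSystem.star)
    refine h.congr_deriv ?_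
    have hn : ‖(v t).1‖ ^ 2 = (v t).1.re * (v t).1.re + (v t).1.im * (v t).1.im := by
      rw [← Complex.normSq_eq_norm_sq, Complex.normSq_apply]
    rw [hn]
    simp [Complex.div_re, Complex.div_im]
    ring
  have hint : ContinuousOn (fun t => ‖(v t).1‖ ^ 2) (Icc a b) := by fun_prop
  have h := intervalIntegral.integral_eq_sub_of_hasDerivAt_of_le hab
    (fun t ht => (hderiv t ht).continuousWithinAt)
    (fun t ht => (hderiv t (Ioo_subset_Icc_self ht)).hasDerivAt (Icc_mem_nhds ht.1 ht.2))
    ((hint.const_smul l.im).neg.intervalIntegrable_of_Icc hab)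
  simp only [intervalIntegral.integral_neg, intervalIntegral.integral_const_mul] at h
  linarith

/-- Square integrability of some nontrivial solution at the singular endpoint. -/
lemma exists_slSystem_integrableOn (hc : 0 < c) (hA : ContinuousOn (slSystem p q l) (Ioc 0 c))
    (hl : l.im ≠ 0) :
    ∃ v : ℝ → ℂ × ℂ, (∀ t ∈ Ioc 0 c, HasDerivWithinAt v (slSystem p q l t (v t)) (Ioc 0 c) t) ∧
      v c ≠ 0 ∧ IntegrableOn (fun t => ‖(v t).1‖ ^ 2) (Ioc 0 c) := by
  obtain ⟨φ, hφc, hφ⟩ := exists_hasDerivWithinAt_linear_Ioc hc hA (1, 0)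
  obtain ⟨ψ, hψc, hψ⟩ := exists_hasDerivWithinAt_linear_Ioc hc hA (0, 1)
  set V : ℂ × ℂ → ℝ → ℂ × ℂ := fun w t => w.1 • φ t + w.2 • ψ t with hV
  have hVd : ∀ w, ∀ t ∈ Ioc 0 c,
      HasDerivWithinAt (V w) (slSystem p q l t (V w t)) (Ioc 0 c) t := fun w t ht =>
    (hφ t ht).slSystem_smul_add_smul (hψ t ht) w.1 w.2
  have hVc : ∀ w, V w c = w := fun w => by simp [hV, hφc, hψc]
  have hVcont : ∀ t, Continuous fun w => V w t := fun t => by fun_prop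
  set g : ℂ × ℂ → ℝ → ℝ := fun w t => l.im * ((V w t).2 * star (V w t).1).im with hg
  have hgreen : ∀ w a b, 0 < a → a ≤ b → b ≤ c →
      l.im ^ 2 * ∫ t in a..b, ‖(V w t).1‖ ^ 2 = g w a - g w b := fun w a b ha hab hb => by
    have hsub : Icc a b ⊆ Ioc 0 c := fun s hs => ⟨ha.trans_le hs.1, hs.2.trans hb⟩
    have h := integral_normSq_slSystem hab fun t ht => (hVd w t (hsub ht)).mono hsub
    simp only [hg, ← mul_sub, ← h]
    ring
  have hganti : ∀ w a b, 0 < a → a ≤ b → b ≤ c → g w b ≤ g w a := fun w a b ha hab hb => by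
    have h := hgreen w a b ha hab hb
    have h0 : 0 ≤ ∫ t in a..b, ‖(V w t).1‖ ^ 2 :=
      intervalIntegral.integral_nonneg hab fun t _ => by positivity
    nlinarith [mul_nonneg (sq_nonneg l.im) h0]
  set s : ℕ → ℝ := fun n => c / (n + 1) with hs
  have hs0 : ∀ n, 0 < s n := fun n => by positivity
  have hsc : ∀ n, s n ≤ c := fun n => div_le_self hc.le (by linarith [n.cast_nonneg (α := ℝ)])
  have hsanti : ∀ n, s (n + 1) ≤ s n := fun n => by
    simp only [hs]
    push_cast
    gcongr
    linarith
  set K : ℕ → Set (ℂ × ℂ) := fun n => Metric.sphere 0 1 ∩ {w | g w (s n) ≤ 0} with hK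
  have hclosed : ∀ n, IsClosed {w | g w (s n) ≤ 0} := fun n => by
    refine isClosed_le ?_ continuous_const
    have h := hVcont (s n)
    exact continuous_const.mul
      (Complex.continuous_im.comp (h.snd.mul (continuous_star.comp h.fst)))
  have hne : ∀ n, (K n).Nonempty := fun n => by
    obtain ⟨w, hw0, hw⟩ : ∃ w : ℂ × ℂ, w ≠ 0 ∧ (V w (s n)).1 = 0 := by
      by_cases h : (φ (s n)).1 = 0
      · exact ⟨(1, 0), by simp, by simp [hV, h]⟩
      · refine ⟨((ψ (s n)).1, -(φ (s n)).1), by simp [h], ?_⟩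
        simp [hV]
        ring
    have hwn : ‖w‖ ≠ 0 := norm_ne_zero_iff.2 hw0
    refine ⟨((‖w‖⁻¹ : ℝ) : ℂ) • w, ?_, ?_⟩
    · simp [norm_smul, hwn]
    · have h : (V (((‖w‖⁻¹ : ℝ) : ℂ) • w) (s n)).1 = 0 := by
        have hlin : V (((‖w‖⁻¹ : ℝ) : ℂ) • w) (s n) = ((‖w‖⁻¹ : ℝ) : ℂ) • V w (s n) := by
          simp only [hV, Prod.smul_fst, Prod.smul_snd]
          module
        rw [hlin, Prod.smul_fst, hw, smul_zero]
      simp only [mem_ofPred_eq, hg, h, star_zero, mul_zero, Complex.zero_im, le_refl]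
  obtain ⟨w, hw⟩ := IsCompact.nonempty_iInter_of_sequence_nonempty_isCompact_isClosed K
    (fun n => inter_subset_inter_right _ fun w hw =>
      (hganti w _ _ (hs0 (n + 1)) (hsanti n) (hsc n)).trans hw)
    hne ((isCompact_sphere 0 1).inter_right (hclosed 0))
    fun n => Metric.isClosed_sphere.inter (hclosed n)
  rw [mem_iInter] at hw
  refine ⟨V w, hVd w, ?_, ?_⟩
  · rw [hVc]
    exact ne_zero_of_mem_unit_sphere ⟨w, (hw 0).1⟩
  · have hcont : ContinuousOn (fun t => ‖(V w t).1‖ ^ 2) (Ioc 0 c) := by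
      have h : ContinuousOn (V w) (Ioc 0 c) := fun t ht => (hVd w t ht).continuousWithinAt
      fun_prop
    have hlim : Tendsto s atTop (nhds 0) := by
      have h := (tendsto_one_div_add_atTop_nhds_zero_nat (𝕜 := ℝ)).const_mul c
      simpa [hs, div_eq_mul_inv] using h
    refine integrableOn_Ioc_of_intervalIntegral_norm_bounded_left (I := -g w c / l.im ^ 2)
      (fun n => ?_) hlim (Eventually.of_forall fun n => ?_)
    · exact ((hcont.mono fun t ht => ⟨(hs0 n).trans_le ht.1, ht.2⟩).integrableOn_Icc).mono_set
        Ioc_subset_Icc_self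
    · have h := hgreen w (s n) c (hs0 n) (hsc n) le_rfl
      have hgn : g w (s n) ≤ 0 := (hw n).2
      simp only [norm_pow, norm_norm]
      rw [← intervalIntegral.integral_of_le (hsc n), le_div_iff₀ (by positivity)]
      linarith

/-- If two square-integrable solutions have independent data at `c`, all solutions are square
integrable. -/
lemma integrableOn_of_slSystem_basis (hA : ContinuousOn (slSystem p q l) (Ioc 0 c))
    {v w z : ℝ → ℂ × ℂ}
    (hv : ∀ t ∈ Ioc 0 c, HasDerivWithinAt v (slSystem p q l t (v t)) (Ioc 0 c) t)
    (hw : ∀ t ∈ Ioc 0 c, HasDerivWithinAt w (slSystem p q l t (w t)) (Ioc 0 c) t)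
    (hz : ∀ t ∈ Ioc 0 c, HasDerivWithinAt z (slSystem p q l t (z t)) (Ioc 0 c) t)
    (hvi : IntegrableOn (fun t => ‖(v t).1‖ ^ 2) (Ioc 0 c))
    (hwi : IntegrableOn (fun t => ‖(w t).1‖ ^ 2) (Ioc 0 c))
    (hdet : (v c).1 * (w c).2 - (v c).2 * (w c).1 ≠ 0) :
    IntegrableOn (fun t => ‖(z t).1‖ ^ 2) (Ioc 0 c) := by
  have hmeas : ∀ {u : ℝ → ℂ × ℂ},
      (∀ t ∈ Ioc 0 c, HasDerivWithinAt u (slSystem p q l t (u t)) (Ioc 0 c) t) →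
      AEStronglyMeasurable (fun t => (u t).1) (volume.restrict (Ioc 0 c)) := fun {u} hu => by
    have h : ContinuousOn u (Ioc 0 c) := fun t ht => (hu t ht).continuousWithinAt
    exact h.fst.aestronglyMeasurable measurableSet_Ioc
  set D := (v c).1 * (w c).2 - (v c).2 * (w c).1 with hD
  set α := ((z c).1 * (w c).2 - (z c).2 * (w c).1) / D with hα
  set β := ((v c).1 * (z c).2 - (v c).2 * (z c).1) / D with hβ
  have heq : EqOn z (fun t => α • v t + β • w t) (Ioc 0 c) := by
    refine eqOn_Ioc_of_hasDerivWithinAt_linear hA hz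
      (fun t ht => (hv t ht).slSystem_smul_add_smul (hw t ht) α β) ?_
    ext1
    · simp only [Prod.fst_add, Prod.smul_fst, smul_eq_mul, hα, hβ]
      field_simp
      rw [hD]
      ring
    · simp only [Prod.snd_add, Prod.smul_snd, smul_eq_mul, hα, hβ]
      field_simp
      rw [hD]
      ring
  rw [IntegrableOn, ← memLp_two_iff_integrable_sq_norm (hmeas hv)] at hvi
  rw [IntegrableOn, ← memLp_two_iff_integrable_sq_norm (hmeas hw)] at hwi
  rw [IntegrableOn, ← memLp_two_iff_integrable_sq_norm (hmeas hz)]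
  refine ((hvi.const_smul α).add (hwi.const_smul β)).ae_eq ?_
  filter_upwards [ae_restrict_mem measurableSet_Ioc] with t ht
  simp [heq ht]

end SturmLiouville

/-- In the limit-point case at the origin, for `Im l ≠ 0` there is a nontrivial
square-integrable solution of `L x = l x` on `(0, c]`, and any two square-integrable
solutions are linearly dependent over `ℂ`. -/
theorem limit_point_unique_L2_solution_at_origin
    (c : ℝ) (hc : 0 < c) (p q : ℝ → ℝ)
    (hq : ContinuousOn q (Ioc 0 c))
    (hp : ContDiffOn ℝ 1 p (Ioc 0 c))
    (hppos : ∀ r ∈ Ioc 0 c, 0 < p r)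
    (l : ℂ) (hl : l.im ≠ 0)
    (hlp : ∃ x : ℝ → ℂ, IsSLSolution p q l (Ioc 0 c) x ∧
      ¬ IntegrableOn (fun r => ‖x r‖ ^ 2) (Ioc 0 c) volume) :
    (∃ χ : ℝ → ℂ, IsSLSolution p q l (Ioc 0 c) χ ∧ (∃ r ∈ Ioc 0 c, χ r ≠ 0) ∧
      IntegrableOn (fun r => ‖χ r‖ ^ 2) (Ioc 0 c) volume) ∧
    (∀ x y : ℝ → ℂ,
      IsSLSolution p q l (Ioc 0 c) x → IntegrableOn (fun r => ‖x r‖ ^ 2) (Ioc 0 c) volume →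
      IsSLSolution p q l (Ioc 0 c) y → IntegrableOn (fun r => ‖y r‖ ^ 2) (Ioc 0 c) volume →
      ∃ α β : ℂ, ¬(α = 0 ∧ β = 0) ∧ ∀ r ∈ Ioc 0 c, α * x r + β * y r = 0) := by
  have hpne : ∀ r ∈ Ioc 0 c, p r ≠ 0 := fun r hr => (hppos r hr).ne'
  have hA : ContinuousOn (slSystem p q l) (Ioc 0 c) :=
    continuousOn_slSystem hp.continuousOn hq hpne
  have hzero : ∀ t ∈ Ioc 0 c, HasDerivWithinAt (fun _ : ℝ => (0 : ℂ × ℂ))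
      (slSystem p q l t 0) (Ioc 0 c) t := fun t _ => by
    rw [map_zero]
    exact hasDerivWithinAt_const t _ _
  have hcmem : c ∈ Ioc 0 c := right_mem_Ioc.2 hc
  refine ⟨?_, fun x y hx hxi hy hyi => ?_⟩
  · obtain ⟨v, hv, hvc, hvi⟩ := exists_slSystem_integrableOn hc hA hl
    refine ⟨fun t => (v t).1, (isSLSolution_iff_exists_slSystem hpne).2 ⟨v, fun _ => rfl, hv⟩,
      ?_, hvi⟩
    by_contra! h
    refine hvc (Prod.ext (h c hcmem) ?_)
    have hd := (hasDerivWithinAt_const c (Ioc 0 c) (0 : ℂ)).congr h (h c hcmem)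
    have hu := (uniqueDiffOn_Ioc 0 c c hcmem).eq_deriv _ (hv c hcmem).fst_slSystem hd
    exact (div_eq_zero_iff.1 hu).resolve_right (Complex.ofReal_ne_zero.2 (hpne c hcmem))
  · obtain ⟨z, hz, hzi⟩ := hlp
    rw [isSLSolution_iff_exists_slSystem hpne] at hx hy hz
    obtain ⟨u, rfl, hu⟩ : ∃ u : ℝ → ℂ × ℂ, (fun t => (u t).1) = x ∧ _ :=
      hx.imp fun u h => ⟨funext h.1, h.2⟩
    obtain ⟨v, rfl, hv⟩ : ∃ v : ℝ → ℂ × ℂ, (fun t => (v t).1) = y ∧ _ :=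
      hy.imp fun u h => ⟨funext h.1, h.2⟩
    obtain ⟨w, rfl, hw⟩ : ∃ w : ℝ → ℂ × ℂ, (fun t => (w t).1) = z ∧ _ :=
      hz.imp fun u h => ⟨funext h.1, h.2⟩
    have hdet : (u c).1 * (v c).2 - (u c).2 * (v c).1 = 0 := by
      by_contra hdet
      exact hzi (integrableOn_of_slSystem_basis hA hu hv hw hxi hyi hdet)
    obtain ⟨α, β, hαβ, h⟩ : ∃ α β : ℂ, ¬(α = 0 ∧ β = 0) ∧ α • u c + β • v c = 0 := by
      by_cases h1 : (u c).1 = 0 ∧ (v c).1 = 0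
      · by_cases h2 : (u c).2 = 0
        · exact ⟨1, 0, by simp, by ext <;> simp [h1.1, h2]⟩
        · refine ⟨-(v c).2, (u c).2, by simp [h2], ?_⟩
          ext1
          · simp [h1.1, h1.2]
          · simp [mul_comm]
      · refine ⟨(v c).1, -(u c).1, by simpa [and_comm] using h1, ?_⟩
        ext1
        · simp [mul_comm]
        · simp only [Prod.snd_add, Prod.smul_snd, smul_eq_mul, Prod.snd_zero]
          linear_combination -hdet
    refine ⟨α, β, hαβ, fun r hr => ?_⟩
    have heq := eqOn_Ioc_of_hasDerivWithinAt_linear hA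
      (fun t ht => (hu t ht).slSystem_smul_add_smul (hv t ht) α β) hzero h hr
    simpa using congrArg Prod.fst heq
end

section
/- (Helly selection theorem.) Let h_n : ℝ → ℝ (n ∈ ℕ) be a sequence of monotone nondecreasing functions and let H : ℝ → ℝ be continuous and nonnegative with |h_n(λ)| ≤ H(λ) for all n and all λ ∈ ℝ. Then there exist a strictly increasing map φ : ℕ → ℕ and a monotone nondecreasing function h : ℝ → ℝ with |h(λ)| ≤ H(λ) for all λ, such that for every λ ∈ ℝ the subsequence h_{φ(k)}(λ) converges to h(λ) as k → ∞. -/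
open Filter

/-- A pointwise bounded sequence of real functions has a subsequence converging at every point
of a given countable set. -/
theorem exists_subseq_tendsto_on_countable {α : Type*} (h : ℕ → α → ℝ) (H : α → ℝ)
    (hbound : ∀ n x, |h n x| ≤ H x) {S : Set α} (hS : S.Countable) :
    ∃ φ : ℕ → ℕ, StrictMono φ ∧ ∃ g : α → ℝ,
      ∀ x ∈ S, Tendsto (fun k => h (φ k) x) atTop (nhds (g x)) := by
  have := hS.to_subtype
  have hcompact : IsCompact (Set.univ.pi fun x : S => Set.Icc (-H x) (H x)) :=
    isCompact_univ_pi fun _ => isCompact_Icc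
  obtain ⟨L, -, φ, hφ, hL⟩ := hcompact.tendsto_subseq (x := fun n (x : S) => h n x)
    fun n x _ => abs_le.1 (hbound n x)
  rw [tendsto_pi_nhds] at hL
  classical
  refine ⟨φ, hφ, fun x => if hx : x ∈ S then L ⟨x, hx⟩ else 0, fun x hx => ?_⟩
  simpa [hx] using hL ⟨x, hx⟩

/-- If monotone functions converge on a dense set to a monotone function, then they converge at
each point where the limit function is continuous. -/
theorem tendsto_of_tendsto_on_dense_of_continuousAt {ι : Type*} {l : Filter ι} {f : ι → ℝ → ℝ}
    (hf : ∀ i, Monotone (f i)) {S : Set ℝ} (hS : Dense S) {G : ℝ → ℝ}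
    (hG : ∀ q ∈ S, Tendsto (fun i => f i q) l (nhds (G q))) {x : ℝ} (hx : ContinuousAt G x) :
    Tendsto (fun i => f i x) l (nhds (G x)) := by
  refine tendsto_order.2 ⟨fun a ha => ?_, fun a ha => ?_⟩
  · obtain ⟨y, hy, hya⟩ := exists_Ioc_subset_of_mem_nhds (hx.eventually (lt_mem_nhds ha))
      (exists_lt x)
    obtain ⟨q, hq, hyq, hqx⟩ := hS.exists_between hy
    filter_upwards [(hG q hq).eventually (lt_mem_nhds (hya ⟨hyq, hqx.le⟩))] with i hi
    exact hi.trans_le (hf i hqx.le)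
  · obtain ⟨y, hy, hya⟩ := exists_Ico_subset_of_mem_nhds (hx.eventually (gt_mem_nhds ha))
      (exists_gt x)
    obtain ⟨q, hq, hxq, hqy⟩ := hS.exists_between hy
    filter_upwards [(hG q hq).eventually (gt_mem_nhds (hya ⟨hxq.le, hqy⟩))] with i hi
    exact (hf i hxq.le).trans_lt hi

/-- Helly selection theorem: a sequence of nondecreasing functions dominated by a
continuous nonnegative function has a pointwise convergent subsequence whose limit
is nondecreasing and dominated by the same function. -/
theorem helly_selection
    (h : ℕ → ℝ → ℝ) (H : ℝ → ℝ)
    (hmono : ∀ n, Monotone (h n))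
    (hHcont : Continuous H) (hHnonneg : ∀ x, 0 ≤ H x)
    (hbound : ∀ n x, |h n x| ≤ H x) :
    ∃ φ : ℕ → ℕ, StrictMono φ ∧
      ∃ g : ℝ → ℝ, Monotone g ∧ (∀ x, |g x| ≤ H x) ∧
        ∀ x, Tendsto (fun k => h (φ k) x) atTop (nhds (g x)) := by
  obtain ⟨S, hScount, hSdense⟩ := TopologicalSpace.exists_countable_dense ℝ
  obtain ⟨φ, hφ, L, hL⟩ := exists_subseq_tendsto_on_countable h H hbound hScount
  let G : ℝ → ℝ := fun x => limsup (fun k => h (φ k) x) atTop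
  have hGmono : Monotone G := fun x y hxy =>
    limsup_le_limsup (.of_forall fun k => hmono (φ k) hxy)
      (isBoundedUnder_of ⟨-H x, fun k => (abs_le.1 (hbound (φ k) x)).1⟩).isCoboundedUnder_le
      (isBoundedUnder_of ⟨H y, fun k => (abs_le.1 (hbound (φ k) y)).2⟩)
  have hGS : ∀ q ∈ S, Tendsto (fun k => h (φ k) q) atTop (nhds (G q)) := fun q hq => by
    simpa only [G, (hL q hq).limsup_eq] using hL q hq
  obtain ⟨ψ, hψ, M, hM⟩ := exists_subseq_tendsto_on_countable (fun k => h (φ k)) H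
    (fun k => hbound (φ k)) hGmono.countable_not_continuousAt
  have hlim : ∀ x, ∃ y, Tendsto (fun k => h (φ (ψ k)) x) atTop (nhds y) := fun x => by
    by_cases hx : ContinuousAt G x
    · exact ⟨G x, (tendsto_of_tendsto_on_dense_of_continuousAt (fun k => hmono (φ k)) hSdense
        hGS hx).comp hψ.tendsto_atTop⟩
    · exact ⟨M x, hM x hx⟩
  choose g hg using hlim
  exact ⟨φ ∘ ψ, hφ.comp hψ, g,
    fun x y hxy => le_of_tendsto_of_tendsto' (hg x) (hg y) fun k => hmono _ hxy,
    fun x => le_of_tendsto' (hg x).abs fun k => hbound _ x, hg⟩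
end
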